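/- arXiv:2602.00752 — 4 statements merged into one kernel-verified Lean document; each statement's English description precedes it below -/
import Mathlib

section
/- Let U be a compact metric space, let f̂ : ℝⁿ × U → ℝⁿ be Lipschitz continuous with constant L_f > 0 (with respect to ‖x−y‖ + d_U(u₁,u₂)), and let ũ : ℝⁿ → P(U) be a relaxed feedback control. Assume there exists L > 0 such that for every x, y ∈ ℝⁿ there is a coupling γ of ũ(x) and ũ(y) with ∫_{U×U} d_U(u₁,u₂) dγ(u₁,u₂) ≤ L ‖x − y‖ (i.e. the 1-Wasserstein distance W(ũ(x), ũ(y)) ≤ L ‖x − y‖). Then the associated vector field x ↦ ∫_U f̂(x,u) d(ũ(x))(u) is locally Lipschitz continuous on ℝⁿ. -/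
open MeasureTheory

/-- If `f` and `g` are continuous on a compact metric space and `‖f u - g v‖ ≤ C * (r + dist u v)`,
then the integrals of `f` and `g` against two probability measures coupled by `γ` differ by at most
`C` times `r` plus the transport cost of `γ`. -/
theorem norm_integral_sub_integral_le_of_coupling
    {U E : Type*} [PseudoMetricSpace U] [CompactSpace U] [MeasurableSpace U] [BorelSpace U]
    [NormedAddCommGroup E] [NormedSpace ℝ E]
    {f g : U → E} (hf : Continuous f) (hg : Continuous g) {C r : ℝ}
    (hfg : ∀ u v, ‖f u - g v‖ ≤ C * (r + dist u v))
    (γ : Measure (U × U)) [IsProbabilityMeasure γ] :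
    ‖∫ u, f u ∂(γ.map Prod.fst) - ∫ u, g u ∂(γ.map Prod.snd)‖ ≤
      C * (r + ∫ p, dist p.1 p.2 ∂γ) := by
  have hdist : Integrable (fun p : U × U => dist p.1 p.2) γ :=
    continuous_dist.integrable_of_hasCompactSupport (HasCompactSupport.of_compactSpace _)
  have hf' : Integrable (fun p : U × U => f p.1) γ :=
    (hf.comp continuous_fst).integrable_of_hasCompactSupport (HasCompactSupport.of_compactSpace _)
  have hg' : Integrable (fun p : U × U => g p.2) γ :=
    (hg.comp continuous_snd).integrable_of_hasCompactSupport (HasCompactSupport.of_compactSpace _)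
  rw [integral_map measurable_fst.aemeasurable
      (hf.stronglyMeasurable_of_hasCompactSupport
        (HasCompactSupport.of_compactSpace f)).aestronglyMeasurable,
    integral_map measurable_snd.aemeasurable
      (hg.stronglyMeasurable_of_hasCompactSupport
        (HasCompactSupport.of_compactSpace g)).aestronglyMeasurable,
    ← integral_sub hf' hg']
  calc ‖∫ p, (f p.1 - g p.2) ∂γ‖
      ≤ ∫ p, C * (r + dist p.1 p.2) ∂γ :=
        norm_integral_le_of_norm_le (((integrable_const r).add hdist).const_mul C)
          (.of_forall fun p => hfg p.1 p.2)
    _ = C * (r + ∫ p, dist p.1 p.2 ∂γ) := by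
        rw [integral_const_mul, integral_add (integrable_const r) hdist]
        simp

/-- If `f̂` is Lipschitz and the relaxed feedback control
`ũ : ℝⁿ → P(U)` is Lipschitz with respect to the 1-Wasserstein distance (expressed via
couplings), then the associated vector field `x ↦ ∫_U f̂(x,u) d(ũ x)(u)` is locally
Lipschitz continuous. -/
theorem relaxed_feedback_vector_field_locally_lipschitz
    {n : ℕ} {U : Type*} [MetricSpace U] [CompactSpace U]
    [MeasurableSpace U] [BorelSpace U]
    (fhat : EuclideanSpace ℝ (Fin n) → U → EuclideanSpace ℝ (Fin n))
    (Lf : ℝ) (hLf : 0 < Lf)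
    (hlip : ∀ (x y : EuclideanSpace ℝ (Fin n)) (u₁ u₂ : U),
      ‖fhat x u₁ - fhat y u₂‖ ≤ Lf * (‖x - y‖ + dist u₁ u₂))
    (utilde : EuclideanSpace ℝ (Fin n) → Measure U)
    (hprob : ∀ x, IsProbabilityMeasure (utilde x))
    (L : ℝ) (hL : 0 < L)
    (hWLip : ∀ x y : EuclideanSpace ℝ (Fin n), ∃ γ : Measure (U × U),
      IsProbabilityMeasure γ ∧
      γ.map Prod.fst = utilde x ∧ γ.map Prod.snd = utilde y ∧
      ∫ p, dist p.1 p.2 ∂γ ≤ L * ‖x - y‖) :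
    LocallyLipschitz (fun x : EuclideanSpace ℝ (Fin n) => ∫ u, fhat x u ∂(utilde x)) := by
  have hcont (x) : Continuous (fhat x) :=
    (LipschitzWith.of_dist_le_mul (K := ⟨Lf, hLf.le⟩) fun u v => by
      have h := hlip x x u v
      rwa [sub_self, norm_zero, zero_add, ← dist_eq_norm] at h).continuous
  refine (LipschitzWith.of_dist_le_mul (K := ⟨Lf * (1 + L), by positivity⟩)
    fun x y => ?_).locallyLipschitz
  obtain ⟨γ, _, hfst, hsnd, hcost⟩ := hWLip x y
  rw [dist_eq_norm, dist_eq_norm, ← hfst, ← hsnd]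
  calc _ ≤ Lf * (‖x - y‖ + ∫ p, dist p.1 p.2 ∂γ) :=
        norm_integral_sub_integral_le_of_coupling (hcont x) (hcont y) (hlip x y) γ
    _ ≤ Lf * (‖x - y‖ + L * ‖x - y‖) := by gcongr
    _ = Lf * (1 + L) * ‖x - y‖ := by ring
end

section
/- Let U be a compact metric space, f̂ : ℝⁿ × U → ℝⁿ Lipschitz with constant L_f > 0 with respect to ‖x−y‖ + d_U(u₁,u₂), and assume that for every x ∈ ℝⁿ the set F(x) := {f̂(x,u) : u ∈ U} is convex; set f(x,u) := (x, f̂(x,u)). Let V be a map from Borel probability measures on ℝⁿ to Borel probability measures on ℝⁿ × ℝⁿ such that: for every μ, the pushforward of V[μ] under (x,v) ↦ x equals μ; for every μ, supp(V[μ]) ⊆ {(x,v) : v ∈ F(x)}; and V maps compactly supported measures to compactly supported measures. Then for every R > 0 there exists a map ũ from Borel probability measures on ℝⁿ to Borel probability measures on ℝⁿ × U such that the pushforward of ũ[μ] under (x,u) ↦ x equals μ for every μ, and f#(ũ[μ]) = V[μ] for every compactly supported μ with supp(μ) ⊆ B(0,R). -/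
open MeasureTheory Metric

/-- The support of a measure on a topological space: the set of points all of whose open
neighborhoods have positive measure. -/
def msupport {X : Type*} [TopologicalSpace X] [MeasurableSpace X] (μ : Measure X) :
    Set X :=
  {x | ∀ s : Set X, IsOpen s → x ∈ s → μ s ≠ 0}

/-- A closed subset of `X × K`, with `K` a compact set of real numbers, has a measurable
selection, given by the least element of each fibre. -/
theorem IsCompact.exists_measurable_selection_of_isClosed {X : Type*} [TopologicalSpace X]
    [MeasurableSpace X] [OpensMeasurableSpace X] {K : Set ℝ} (hK : IsCompact K)
    {D : Set (X × K)} (hD : IsClosed D) :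
    ∃ s : X → ℝ, Measurable s ∧ ∀ x, (∃ t, (x, t) ∈ D) → ∃ t, (x, t) ∈ D ∧ s x = t := by
  have : CompactSpace K := isCompact_iff_compactSpace.mp hK
  obtain ⟨b, hb⟩ := hK.bddAbove
  set S : X → Set ℝ := fun x => insert b (Subtype.val '' {t : K | (x, t) ∈ D}) with hS
  have hScomp (x : X) : IsCompact (S x) :=
    (((hD.preimage (Continuous.prodMk_right x)).isCompact).image continuous_subtype_val).insert b
  have hSmin (x : X) : sInf (S x) ∈ S x := (hScomp x).sInf_mem (Set.insert_nonempty _ _)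
  refine ⟨fun x => sInf (S x), measurable_of_Iic fun a => ?_, fun x ⟨t, ht⟩ => ?_⟩
  · have hpre : (fun x => sInf (S x)) ⁻¹' Set.Iic a =
        {_x | b ≤ a} ∪ Prod.fst '' (D ∩ {p | (p.2 : ℝ) ≤ a}) := by
      ext x
      constructor
      · intro hx
        rcases hSmin x with h | ⟨t, ht, h⟩
        · exact Or.inl (h ▸ hx)
        · exact Or.inr ⟨(x, t), ⟨ht, h.trans_le hx⟩, rfl⟩
      · rintro (h | ⟨⟨y, t⟩, ⟨ht, hta⟩, rfl⟩)
        · exact (csInf_le (hScomp x).bddBelow (Set.mem_insert _ _)).trans h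
        · exact (csInf_le (hScomp y).bddBelow (Set.mem_insert_of_mem _ ⟨t, ht, rfl⟩)).trans hta
    rw [hpre]
    refine (MeasurableSet.const _).union (IsClosed.measurableSet ?_)
    exact isClosedMap_fst_of_compactSpace _
      (hD.inter (isClosed_le (continuous_subtype_val.comp continuous_snd) continuous_const))
  · rcases hSmin x with h | ⟨t', ht', h⟩
    · refine ⟨t, ht, le_antisymm ?_ ?_⟩
      · exact csInf_le (hScomp x).bddBelow (Set.mem_insert_of_mem _ ⟨t, ht, rfl⟩)
      · exact (hb t.2).trans h.ge
    · exact ⟨t', ht', h.symm⟩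

/-- A closed subset of `X × U`, with `U` a compact metric space, has a measurable selection. -/
theorem IsClosed.exists_measurable_selection {X U : Type*} [TopologicalSpace X]
    [MeasurableSpace X] [OpensMeasurableSpace X] [MetricSpace U] [CompactSpace U] [Nonempty U]
    [MeasurableSpace U] [BorelSpace U] {C : Set (X × U)} (hC : IsClosed C) :
    ∃ s : X → U, Measurable s ∧ ∀ x, (∃ u, (x, u) ∈ C) → (x, s x) ∈ C := by
  obtain ⟨g₀, hg₀, hg₀s⟩ := exists_nat_bool_continuous_surjective_of_compact U
  set g : cantorSet → U := g₀ ∘ cantorSetHomeomorphNatToBool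
  have hg : Continuous g := hg₀.comp cantorSetHomeomorphNatToBool.continuous
  have hgs : g.Surjective := hg₀s.comp cantorSetHomeomorphNatToBool.surjective
  obtain ⟨s, hs, hsD⟩ := isCompact_cantorSet.exists_measurable_selection_of_isClosed
    (hC.preimage (continuous_id.prodMap hg))
  obtain ⟨g', hg', hgg'⟩ := (MeasurableEmbedding.subtype_coe
    isClosed_cantorSet.measurableSet).exists_measurable_extend hg.measurable
    fun _ => inferInstance
  refine ⟨g' ∘ s, hg'.comp hs, fun x ⟨u, hu⟩ => ?_⟩
  obtain ⟨t, rfl⟩ := hgs u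
  obtain ⟨t', ht', hst⟩ := hsD x ⟨t, hu⟩
  have h : g' (s x) = g t' := by rw [hst, ← hgg']; rfl
  simpa [h] using ht'

theorem msupport_eq_support {X : Type*} [TopologicalSpace X] [MeasurableSpace X]
    (μ : Measure X) : msupport μ = μ.support := by
  rw [Measure.support_eq_forall_isOpen]
  ext x
  simp only [msupport, Set.mem_ofPred_eq, pos_iff_ne_zero]
  exact forall_congr' fun _ => forall_comm

/-- A probability measure on `X × Y` whose support lies in the graph of the set-valued map
`x ↦ {f x u | u}` is the pushforward of a probability measure on `X × U` under
`(x, u) ↦ (x, f x u)`. -/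
theorem exists_map_prodMk_eq_of_msupport_subset {X Y U : Type*}
    [TopologicalSpace X] [SecondCountableTopology X] [MeasurableSpace X] [BorelSpace X]
    [TopologicalSpace Y] [SecondCountableTopology Y] [T2Space Y] [MeasurableSpace Y]
    [BorelSpace Y] [MetricSpace U] [CompactSpace U] [MeasurableSpace U] [BorelSpace U]
    {f : X → U → Y} (hf : Continuous fun p : X × U => f p.1 p.2)
    (ν : Measure (X × Y)) [IsProbabilityMeasure ν]
    (hν : msupport ν ⊆ {p | ∃ u, f p.1 u = p.2}) :
    ∃ η : Measure (X × U), IsProbabilityMeasure η ∧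
      η.map (fun p => (p.1, f p.1 p.2)) = ν := by
  have hae : ∀ᵐ p ∂ν, ∃ u, f p.1 u = p.2 :=
    Filter.mem_of_superset Measure.support_mem_ae (msupport_eq_support ν ▸ hν)
  have : Nonempty U := let ⟨_, u, _⟩ := hae.exists; ⟨u⟩
  have hC : IsClosed {q : (X × Y) × U | f q.1.1 q.2 = q.1.2} :=
    isClosed_eq (hf.comp (by fun_prop : Continuous fun q : (X × Y) × U => (q.1.1, q.2)))
      (by fun_prop)
  obtain ⟨s, hs, hsC⟩ := hC.exists_measurable_selection
  have hm : Measurable fun p : X × Y => (p.1, s p) := measurable_fst.prodMk hs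
  refine ⟨ν.map fun p => (p.1, s p), Measure.isProbabilityMeasure_map hm.aemeasurable, ?_⟩
  rw [Measure.map_map (measurable_fst.prodMk hf.measurable) hm]
  refine (Measure.map_congr ?_).trans Measure.map_id
  filter_upwards [hae] with p hp
  exact Prod.ext rfl (hsC p hp)

/-- Every measure vector field `V` associated with the control system
`ẋ = f̂(x,u)` (with `U` compact, `f̂` Lipschitz, and `F(x) = {f̂(x,u) : u ∈ U}` convex),
mapping compactly supported measures to compactly supported measures, is realized,
on measures supported in any fixed ball `B(0,R)`, by a measure control `ũ`:
`f#(ũ[μ]) = V[μ]`. -/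
theorem measure_vector_field_eq_measure_control
    {n : ℕ} {U : Type*} [MetricSpace U] [CompactSpace U]
    [MeasurableSpace U] [BorelSpace U]
    (fhat : EuclideanSpace ℝ (Fin n) → U → EuclideanSpace ℝ (Fin n))
    (Lf : ℝ) (hLf : 0 < Lf)
    (hlip : ∀ (x y : EuclideanSpace ℝ (Fin n)) (u₁ u₂ : U),
      ‖fhat x u₁ - fhat y u₂‖ ≤ Lf * (‖x - y‖ + dist u₁ u₂))
    (hconv : ∀ x : EuclideanSpace ℝ (Fin n), Convex ℝ {v | ∃ u : U, fhat x u = v})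
    (V : Measure (EuclideanSpace ℝ (Fin n)) →
      Measure (EuclideanSpace ℝ (Fin n) × EuclideanSpace ℝ (Fin n)))
    (hVprob : ∀ μ, IsProbabilityMeasure μ → IsProbabilityMeasure (V μ))
    (hVmarg : ∀ μ, IsProbabilityMeasure μ → (V μ).map Prod.fst = μ)
    (hVsupp : ∀ μ, IsProbabilityMeasure μ →
      msupport (V μ) ⊆ {p : EuclideanSpace ℝ (Fin n) × EuclideanSpace ℝ (Fin n) |
        ∃ u : U, fhat p.1 u = p.2})
    (hVcpt : ∀ μ, IsProbabilityMeasure μ → IsCompact (msupport μ) →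
      IsCompact (msupport (V μ))) :
    ∀ R > (0 : ℝ),
      ∃ utilde : Measure (EuclideanSpace ℝ (Fin n)) →
        Measure (EuclideanSpace ℝ (Fin n) × U),
        (∀ μ, IsProbabilityMeasure μ →
          IsProbabilityMeasure (utilde μ) ∧ (utilde μ).map Prod.fst = μ) ∧
        (∀ μ, IsProbabilityMeasure μ → IsCompact (msupport μ) →
          msupport μ ⊆ ball (0 : EuclideanSpace ℝ (Fin n)) R →
          (utilde μ).map (fun p => (p.1, fhat p.1 p.2)) = V μ) := by
  intro R _
  have hcont : Continuous fun p : EuclideanSpace ℝ (Fin n) × U => fhat p.1 p.2 := by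
    refine continuous_iff_continuousAt.2 fun q => tendsto_iff_norm_sub_tendsto_zero.2 ?_
    refine squeeze_zero (fun _ => norm_nonneg _) (fun p => hlip p.1 q.1 p.2 q.2) ?_
    have h : Continuous fun p : EuclideanSpace ℝ (Fin n) × U =>
        Lf * (‖p.1 - q.1‖ + dist p.2 q.2) := by fun_prop
    simpa using h.tendsto q
  have hlift (μ : Measure (EuclideanSpace ℝ (Fin n))) :
      ∃ η : Measure (EuclideanSpace ℝ (Fin n) × U), IsProbabilityMeasure μ →
        IsProbabilityMeasure η ∧ η.map (fun p => (p.1, fhat p.1 p.2)) = V μ := by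
    by_cases hμ : IsProbabilityMeasure μ
    · have := hVprob μ hμ
      obtain ⟨η, hη⟩ := exists_map_prodMk_eq_of_msupport_subset hcont (V μ) (hVsupp μ hμ)
      exact ⟨η, fun _ => hη⟩
    · exact ⟨0, fun h => absurd h hμ⟩
  choose utilde hu using hlift
  refine ⟨utilde, fun μ hμ => ⟨(hu μ hμ).1, ?_⟩, fun μ hμ _ _ => (hu μ hμ).2⟩
  have h := hVmarg μ hμ
  rwa [← (hu μ hμ).2,
    Measure.map_map measurable_fst (measurable_fst.prodMk hcont.measurable)] at h
end

section
/- Let U be a compact metric space and f̂ : ℝⁿ × U → ℝⁿ Lipschitz with constant L_f > 0 with respect to ‖x−y‖ + d_U(u₁,u₂); set f(x,u) := (x, f̂(x,u)). Let ũ be a measure control which is 𝒲-continuous at every compactly supported μ, in the following sense: for every compactly supported μ and every sequence of compactly supported measures μ_k with W₁(μ_k, μ) → 0, there exist couplings S_k of ũ[μ_k] and ũ[μ] such that the pushforward of S_k under ((x,u₁),(y,u₂)) ↦ (x,y) is an optimal coupling of μ_k and μ, and ∫ d_U(u₁,u₂) dS_k → 0. Then for every compactly supported Borel probability measure μ₀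 on ℝⁿ and every T > 0 there exists a map t ↦ μ(t) from [0,T] to compactly supported Borel probability measures on ℝⁿ with μ(0) = μ₀ which is a solution of the measure differential equation μ̇ = V^ũ[μ]: for every g ∈ C_c^∞(ℝⁿ) and every t ∈ [0,T], ∫_{ℝⁿ} g dμ(t) = ∫_{ℝⁿ} g dμ₀ + ∫_0^t ( ∫_{ℝⁿ×U} ∇g(x) · f̂(x,u) d(ũ[μ(s)])(x,u) ) ds. -/
open MeasureTheory Metric Filter RealInnerProductSpace

/-- A coupling of two measures. -/
def IsCoupling {X Y : Type*} [MeasurableSpace X] [MeasurableSpace Y]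
    (γ : Measure (X × Y)) (σ : Measure X) (τ : Measure Y) : Prop :=
  γ.map Prod.fst = σ ∧ γ.map Prod.snd = τ

/-- The 1-Wasserstein distance, as the infimum of transport costs over couplings. -/
noncomputable def W1 {X : Type*} [MeasurableSpace X] [PseudoMetricSpace X]
    (σ τ : Measure X) : ℝ :=
  sInf {c : ℝ | ∃ γ : Measure (X × X), IsProbabilityMeasure γ ∧ IsCoupling γ σ τ ∧
    (∫ p, dist p.1 p.2 ∂γ) = c}

/-- An optimal coupling: a coupling attaining the 1-Wasserstein distance. -/
def IsOptimalCoupling {X : Type*} [MeasurableSpace X] [PseudoMetricSpace X]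
    (γ : Measure (X × X)) (σ τ : Measure X) : Prop :=
  IsProbabilityMeasure γ ∧ IsCoupling γ σ τ ∧ (∫ p, dist p.1 p.2 ∂γ) = W1 σ τ

lemma exists_isCoupling_add {X Y : Type*} [MeasurableSpace X] [MeasurableSpace Y]
    (μ : Measure X) (ν : Measure Y) [IsProbabilityMeasure μ] [IsProbabilityMeasure ν]
    (γ₀ : Measure (X × Y)) (h₁ : γ₀.map Prod.fst ≤ μ) (h₂ : γ₀.map Prod.snd ≤ ν) :
    ∃ γ₁ : Measure (X × Y), IsCoupling (γ₀ + γ₁) μ ν ∧ γ₁ Set.univ = 1 - γ₀ Set.univ := by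
  have e₁ : γ₀.map Prod.fst Set.univ = γ₀ Set.univ := by
    rw [Measure.map_apply measurable_fst MeasurableSet.univ, Set.preimage_univ]
  have e₂ : γ₀.map Prod.snd Set.univ = γ₀ Set.univ := by
    rw [Measure.map_apply measurable_snd MeasurableSet.univ, Set.preimage_univ]
  have hle : γ₀ Set.univ ≤ 1 := by
    rw [← e₁, ← measure_univ (μ := μ)]
    exact h₁ _
  have : IsFiniteMeasure (γ₀.map Prod.fst) := isFiniteMeasure_of_le μ h₁
  have : IsFiniteMeasure (γ₀.map Prod.snd) := isFiniteMeasure_of_le ν h₂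
  have f₁ : (μ - γ₀.map Prod.fst) Set.univ = 1 - γ₀ Set.univ := by
    rw [Measure.sub_apply MeasurableSet.univ h₁, e₁, measure_univ]
  have f₂ : (ν - γ₀.map Prod.snd) Set.univ = 1 - γ₀ Set.univ := by
    rw [Measure.sub_apply MeasurableSet.univ h₂, e₂, measure_univ]
  have hfin : 1 - γ₀ Set.univ ≠ ⊤ := ne_top_of_le_ne_top ENNReal.one_ne_top tsub_le_self
  by_cases h0 : 1 - γ₀ Set.univ = 0
  · rw [h0] at f₁ f₂
    refine ⟨0, ⟨?_, ?_⟩, by simp [h0]⟩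
    · conv_rhs => rw [← Measure.sub_add_cancel_of_le h₁, Measure.measure_univ_eq_zero.1 f₁]
      simp
    · conv_rhs => rw [← Measure.sub_add_cancel_of_le h₂, Measure.measure_univ_eq_zero.1 f₂]
      simp
  · refine ⟨(1 - γ₀ Set.univ)⁻¹ • (μ - γ₀.map Prod.fst).prod (ν - γ₀.map Prod.snd),
      ⟨?_, ?_⟩, ?_⟩
    · rw [Measure.map_add _ _ measurable_fst, Measure.map_smul, Measure.map_fst_prod, f₂,
        smul_smul, ENNReal.inv_mul_cancel h0 hfin, one_smul, add_comm,
        Measure.sub_add_cancel_of_le h₁]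
    · rw [Measure.map_add _ _ measurable_snd, Measure.map_smul, Measure.map_snd_prod, f₁,
        smul_smul, ENNReal.inv_mul_cancel h0 hfin, one_smul, add_comm,
        Measure.sub_add_cancel_of_le h₂]
    · rw [Measure.smul_apply, ← Set.univ_prod_univ, Measure.prod_prod, f₁, Set.univ_prod_univ, f₂,
        smul_eq_mul, ← mul_assoc, ENNReal.inv_mul_cancel h0 hfin, one_mul]

lemma exists_isCoupling_of_partition {X : Type*} [MeasurableSpace X]
    (μ ν : Measure X) [IsProbabilityMeasure μ] [IsProbabilityMeasure ν]
    (A : ℕ → Set X) (hA : ∀ n, MeasurableSet (A n)) (hU : ⋃ n, A n = Set.univ)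
    (hd : Pairwise fun m n => Disjoint (A m) (A n)) :
    ∃ γ : Measure (X × X), IsCoupling γ μ ν ∧
      γ {p | ∃ n, p.1 ∈ A n ∧ p.2 ∈ A n}ᶜ ≤ ∑' n, (μ (A n) - ν (A n)) := by
  set c : ℕ → ENNReal := fun n => min (μ (A n)) (ν (A n)) / (μ (A n) * ν (A n)) with hc
  have hcne : ∀ n, c n * (μ (A n) * ν (A n)) = min (μ (A n)) (ν (A n)) := fun n => by
    refine ENNReal.div_mul_cancel' (fun h => ?_) fun h => ?_
    · rcases mul_eq_zero.1 h with h | h <;> simp [h]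
    · exact absurd h (ENNReal.mul_ne_top (measure_ne_top _ _) (measure_ne_top _ _))
  have hc1 : ∀ n, c n * ν (A n) ≤ 1 := fun n => by
    by_cases h : μ (A n) = 0
    · simp [hc, h]
    · rw [← ENNReal.mul_le_mul_iff_left h (measure_ne_top μ _), one_mul, mul_assoc,
        mul_comm (ν (A n)), hcne]
      exact min_le_left _ _
  have hc2 : ∀ n, c n * μ (A n) ≤ 1 := fun n => by
    by_cases h : ν (A n) = 0
    · simp [hc, h]
    · rw [← ENNReal.mul_le_mul_iff_left h (measure_ne_top ν _), one_mul, mul_assoc, hcne]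
      exact min_le_right _ _
  have hsum : ∀ κ : Measure X, Measure.sum (fun n => κ.restrict (A n)) = κ := fun κ => by
    rw [← Measure.restrict_iUnion hd hA, hU, Measure.restrict_univ]
  set γ₀ : Measure (X × X) :=
    Measure.sum fun n => c n • (μ.restrict (A n)).prod (ν.restrict (A n)) with hγ₀
  have h₁ : γ₀.map Prod.fst ≤ μ := by
    conv_rhs => rw [← hsum μ]
    rw [hγ₀, Measure.map_sum measurable_fst.aemeasurable]
    refine Measure.le_iff.2 fun s hs => ?_
    rw [Measure.sum_apply _ hs, Measure.sum_apply _ hs]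
    refine ENNReal.tsum_le_tsum fun n => ?_
    rw [Measure.map_smul, Measure.map_fst_prod, smul_smul, Measure.restrict_apply_univ,
      Measure.smul_apply, smul_eq_mul]
    exact mul_le_of_le_one_left' (hc1 n)
  have h₂ : γ₀.map Prod.snd ≤ ν := by
    conv_rhs => rw [← hsum ν]
    rw [hγ₀, Measure.map_sum measurable_snd.aemeasurable]
    refine Measure.le_iff.2 fun s hs => ?_
    rw [Measure.sum_apply _ hs, Measure.sum_apply _ hs]
    refine ENNReal.tsum_le_tsum fun n => ?_
    rw [Measure.map_smul, Measure.map_snd_prod, smul_smul, Measure.restrict_apply_univ,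
      Measure.smul_apply, smul_eq_mul]
    exact mul_le_of_le_one_left' (hc2 n)
  obtain ⟨γ₁, hγ, hm⟩ := exists_isCoupling_add μ ν γ₀ h₁ h₂
  refine ⟨γ₀ + γ₁, hγ, ?_⟩
  have hS : {p : X × X | ∃ n, p.1 ∈ A n ∧ p.2 ∈ A n} = ⋃ n, A n ×ˢ A n := by
    ext p
    simp
  have hz : γ₀ {p | ∃ n, p.1 ∈ A n ∧ p.2 ∈ A n}ᶜ = 0 := by
    rw [hS, hγ₀, Measure.sum_apply _ (MeasurableSet.iUnion fun n => (hA n).prod (hA n)).compl,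
      ENNReal.tsum_eq_zero]
    intro n
    rw [Measure.smul_apply, Measure.prod_restrict, Measure.restrict_apply
      (MeasurableSet.iUnion fun n => (hA n).prod (hA n)).compl]
    have he : (⋃ n, A n ×ˢ A n)ᶜ ∩ A n ×ˢ A n = ∅ := by
      rw [← Set.disjoint_iff_inter_eq_empty, Set.disjoint_compl_left_iff_subset]
      exact Set.subset_iUnion (fun n => A n ×ˢ A n) n
    rw [he, measure_empty, smul_zero]
  have hmass : γ₀ Set.univ = ∑' n, min (μ (A n)) (ν (A n)) := by
    rw [hγ₀, Measure.sum_apply _ MeasurableSet.univ]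
    refine tsum_congr fun n => ?_
    rw [Measure.smul_apply, ← Set.univ_prod_univ, Measure.prod_prod, Measure.restrict_apply_univ,
      Measure.restrict_apply_univ, smul_eq_mul, hcne]
  rw [Measure.add_apply, hz, zero_add]
  refine (measure_mono (Set.subset_univ _)).trans ?_
  rw [hm, tsub_le_iff_left, hmass, ← ENNReal.tsum_add, ← measure_univ (μ := μ), ← hU,
    measure_iUnion hd hA]
  refine ENNReal.tsum_le_tsum fun n => ?_
  rcases le_total (μ (A n)) (ν (A n)) with h | h
  · simp [h]
  · simp [h]

lemma IsCoupling.isProbabilityMeasure {X Y : Type*} [MeasurableSpace X] [MeasurableSpace Y]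
    {γ : Measure (X × Y)} {μ : Measure X} {ν : Measure Y} [IsProbabilityMeasure μ]
    (h : IsCoupling γ μ ν) : IsProbabilityMeasure γ := by
  constructor
  rw [← measure_univ (μ := μ), ← h.1, Measure.map_apply measurable_fst MeasurableSet.univ,
    Set.preimage_univ]

lemma W1_nonneg {X : Type*} [MeasurableSpace X] [PseudoMetricSpace X] (σ τ : Measure X) :
    0 ≤ W1 σ τ := by
  refine Real.sInf_nonneg ?_
  rintro c ⟨γ, -, -, rfl⟩
  exact integral_nonneg fun p => dist_nonneg

lemma W1_le_integral {X : Type*} [MeasurableSpace X] [PseudoMetricSpace X] {σ τ : Measure X}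
    [IsProbabilityMeasure σ] {γ : Measure (X × X)} (h : IsCoupling γ σ τ) :
    W1 σ τ ≤ ∫ p, dist p.1 p.2 ∂γ := by
  refine csInf_le ⟨0, ?_⟩ ⟨γ, h.isProbabilityMeasure, h, rfl⟩
  rintro c ⟨γ, -, -, rfl⟩
  exact integral_nonneg fun p => dist_nonneg

lemma W1_le_of_partition {X : Type*} [MeasurableSpace X] [PseudoMetricSpace X]
    [OpensMeasurableSpace X] [SecondCountableTopology X]
    (μ ν : Measure X) [IsProbabilityMeasure μ] [IsProbabilityMeasure ν]
    {K : Set X} {D : ℝ} (hD : ∀ x ∈ K, ∀ y ∈ K, dist x y ≤ D) (hD0 : 0 ≤ D)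
    (hμ : ∀ᵐ x ∂μ, x ∈ K) (hν : ∀ᵐ x ∂ν, x ∈ K)
    (A : ℕ → Set X) (hA : ∀ n, MeasurableSet (A n)) (hU : ⋃ n, A n = Set.univ)
    (hd : Pairwise fun m n => Disjoint (A m) (A n))
    {ε : ℝ} (hε : 0 ≤ ε) (hAε : ∀ n, ∀ x ∈ A n, ∀ y ∈ A n, dist x y ≤ ε) :
    W1 μ ν ≤ ε + D * (∑' n, (μ (A n) - ν (A n))).toReal := by
  obtain ⟨γ, hγ, hle⟩ := exists_isCoupling_of_partition μ ν A hA hU hd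
  have := hγ.isProbabilityMeasure
  refine (W1_le_integral hγ).trans ?_
  set S := {p : X × X | ∃ n, p.1 ∈ A n ∧ p.2 ∈ A n}ᶜ with hS
  have hSm : MeasurableSet S := by
    refine MeasurableSet.compl ?_
    have : {p : X × X | ∃ n, p.1 ∈ A n ∧ p.2 ∈ A n} = ⋃ n, A n ×ˢ A n := by
      ext p
      simp
    rw [this]
    exact MeasurableSet.iUnion fun n => (hA n).prod (hA n)
  have hfin : ∑' n, (μ (A n) - ν (A n)) ≠ ⊤ := by
    refine ne_top_of_le_ne_top (measure_ne_top μ Set.univ) ?_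
    rw [← hU, measure_iUnion hd hA]
    exact ENNReal.tsum_le_tsum fun n => tsub_le_self
  have k₁ : ∀ᵐ p ∂γ, p.1 ∈ K := by
    rw [← hγ.1] at hμ
    exact ae_of_ae_map measurable_fst.aemeasurable hμ
  have k₂ : ∀ᵐ p ∂γ, p.2 ∈ K := by
    rw [← hγ.2] at hν
    exact ae_of_ae_map measurable_snd.aemeasurable hν
  have hγi : Integrable (fun p : X × X => ε + S.indicator (fun _ => D) p) γ :=
    (integrable_const _).add ((integrable_const _).indicator hSm)
  calc ∫ p, dist p.1 p.2 ∂γ ≤ ∫ p, (ε + S.indicator (fun _ => D) p) ∂γ := by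
        refine integral_mono_of_nonneg (Eventually.of_forall fun p => dist_nonneg) hγi ?_
        filter_upwards [k₁, k₂] with p h₁ h₂
        by_cases hp : p ∈ S
        · simp only [Set.indicator_of_mem hp]
          linarith [hD _ h₁ _ h₂]
        · simp only [Set.indicator_of_notMem hp, add_zero]
          obtain ⟨n, h, h'⟩ := Set.notMem_compl_iff.1 hp
          exact hAε n _ h _ h'
    _ = ε + γ.real S * D := by
        rw [integral_add (integrable_const _) ((integrable_const _).indicator hSm),
          integral_indicator_const _ hSm]
        simp
    _ ≤ _ := by
        rw [mul_comm]
        gcongr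
        exact ENNReal.toReal_mono hfin hle

lemma exists_partition_null_frontier {X : Type*} [MeasurableSpace X] [PseudoMetricSpace X]
    [OpensMeasurableSpace X] [TopologicalSpace.SeparableSpace X] [Nonempty X]
    (μ : Measure X) [IsFiniteMeasure μ] {ε : ℝ} (hε : 0 < ε) :
    ∃ A : ℕ → Set X, (∀ n, MeasurableSet (A n)) ∧ ⋃ n, A n = Set.univ ∧
      (Pairwise fun m n => Disjoint (A m) (A n)) ∧
      (∀ n, ∀ x ∈ A n, ∀ y ∈ A n, dist x y ≤ ε) ∧ ∀ n, μ (frontier (A n)) = 0 := by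
  have hr : ∀ n, ∃ r ∈ Set.Ioo (ε / 4) (ε / 2),
      μ (frontier (Metric.thickening r {TopologicalSpace.denseSeq X n})) = 0 := fun n =>
    exists_null_frontier_thickening μ _ (by linarith)
  choose r hr hnull using hr
  simp only [Metric.thickening_singleton] at hnull
  set B : ℕ → Set X := fun n => Metric.ball (TopologicalSpace.denseSeq X n) (r n) with hB
  refine ⟨disjointed B, MeasurableSet.disjointed fun n => measurableSet_ball, ?_,
    disjoint_disjointed B, fun n x hx y hy => ?_, fun n => ?_⟩
  · rw [iUnion_disjointed, Set.eq_univ_iff_forall]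
    intro x
    obtain ⟨n, hn⟩ := (TopologicalSpace.denseRange_denseSeq X).exists_dist_lt x
      (show 0 < ε / 4 by linarith)
    exact Set.mem_iUnion.2 ⟨n, hn.trans (hr n).1⟩
  · have h₁ := disjointed_subset B n hx
    have h₂ := disjointed_subset B n hy
    have h₃ := (hr n).2
    rw [hB, Metric.mem_ball] at h₁ h₂
    linarith [dist_triangle_right x y (TopologicalSpace.denseSeq X n)]
  · refine disjointedRec (p := fun s => μ (frontier s) = 0) (fun {t i} ht => ?_) (hnull n)
    rw [sdiff_eq]
    exact null_frontier_inter ht (by simpa [frontier_compl] using hnull i)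

lemma tendsto_tsum_tsub_measure {X : Type*} [MeasurableSpace X]
    (μ : Measure X) [IsFiniteMeasure μ] (μs : ℕ → Measure X)
    (A : ℕ → Set X) (hA : ∀ n, MeasurableSet (A n))
    (hd : Pairwise fun m n => Disjoint (A m) (A n))
    (h : ∀ n, Tendsto (fun k => μs k (A n)) atTop (nhds (μ (A n)))) :
    Tendsto (fun k => ∑' n, (μ (A n) - μs k (A n))) atTop (nhds 0) := by
  simp_rw [← lintegral_count]
  rw [show (0 : ENNReal) = ∫⁻ _ : ℕ, 0 ∂Measure.count by simp]
  refine tendsto_lintegral_of_dominated_convergence (fun n => μ (A n))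
    (fun k => measurable_of_countable _) (fun k => Eventually.of_forall fun n => tsub_le_self) ?_
    (Eventually.of_forall fun n => ?_)
  · rw [lintegral_count, ← measure_iUnion hd hA]
    exact measure_ne_top _ _
  · have := ENNReal.Tendsto.sub (tendsto_const_nhds (x := μ (A n)) (f := atTop)) (h n)
      (Or.inl (measure_ne_top _ _))
    simpa using this

lemma W1_comm {X : Type*} [MeasurableSpace X] [PseudoMetricSpace X] (σ τ : Measure X) :
    W1 σ τ = W1 τ σ := by
  have key : ∀ (σ τ : Measure X) (c : ℝ),
      (∃ γ : Measure (X × X), IsProbabilityMeasure γ ∧ IsCoupling γ σ τ ∧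
        ∫ p, dist p.1 p.2 ∂γ = c) →
      ∃ γ : Measure (X × X), IsProbabilityMeasure γ ∧ IsCoupling γ τ σ ∧
        ∫ p, dist p.1 p.2 ∂γ = c := by
    rintro σ τ c ⟨γ, hp, ⟨h₁, h₂⟩, hc⟩
    refine ⟨γ.map Prod.swap, Measure.isProbabilityMeasure_map measurable_swap.aemeasurable,
      ⟨?_, ?_⟩, ?_⟩
    · rw [Measure.map_map measurable_fst measurable_swap, ← h₂]
      rfl
    · rw [Measure.map_map measurable_snd measurable_swap, ← h₁]
      rfl
    · rw [← hc]
      refine (integral_map_equiv MeasurableEquiv.prodComm _).trans ?_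
      exact integral_congr_ae (Eventually.of_forall fun p => dist_comm _ _)
  unfold W1
  congr 1
  ext c
  exact ⟨key σ τ c, key τ σ c⟩

theorem tendsto_W1_of_tendsto {X : Type*} [MeasurableSpace X] [PseudoMetricSpace X]
    [BorelSpace X] [SecondCountableTopology X]
    {K : Set X} (hK : Bornology.IsBounded K)
    (μs : ℕ → ProbabilityMeasure X) (μ : ProbabilityMeasure X)
    (hs : ∀ k, ∀ᵐ x ∂(μs k : Measure X), x ∈ K) (hμ : ∀ᵐ x ∂(μ : Measure X), x ∈ K)
    (h : Tendsto μs atTop (nhds μ)) :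
    Tendsto (fun k => W1 (μs k : Measure X) (μ : Measure X)) atTop (nhds 0) := by
  have : Nonempty X := μ.nonempty
  rw [Metric.tendsto_atTop]
  intro ε hε
  obtain ⟨A, hA, hU, hd, hAε, hfr⟩ :=
    exists_partition_null_frontier (μ : Measure X) (show 0 < ε / 2 by linarith)
  have hlim := tendsto_tsum_tsub_measure (μ : Measure X) (fun k => (μs k : Measure X)) A hA hd
    fun n => ProbabilityMeasure.tendsto_measure_of_null_frontier_of_tendsto' h (hfr n)
  have hlim' := ((ENNReal.tendsto_toReal ENNReal.zero_ne_top).comp hlim).const_mul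
    (Metric.diam K)
  rw [ENNReal.toReal_zero, mul_zero] at hlim'
  obtain ⟨N, hN⟩ := Metric.tendsto_atTop.1 hlim' (ε / 2) (by linarith)
  refine ⟨N, fun k hk => ?_⟩
  have h₁ := W1_le_of_partition (μ : Measure X) (μs k : Measure X)
    (fun x hx y hy => Metric.dist_le_diam_of_mem hK hx hy) Metric.diam_nonneg hμ (hs k) A hA hU hd
    (show 0 ≤ ε / 2 by linarith) hAε
  have h₂ := hN k hk
  rw [Real.dist_eq, sub_zero, abs_lt] at h₂
  rw [Real.dist_eq, sub_zero, abs_of_nonneg (W1_nonneg _ _), W1_comm]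
  simp only [Function.comp_apply] at h₂
  linarith [h₂.2]

theorem exists_tendsto_subseq_of_equilipschitz {X I : Type*} [MeasurableSpace X]
    [PseudoMetricSpace X] [T2Space X] [BorelSpace X] [SecondCountableTopology X]
    [PseudoMetricSpace I] [TopologicalSpace.SeparableSpace I] [Nonempty I]
    {K : Set X} (hK : IsCompact K) (m : ℕ → I → ProbabilityMeasure X)
    (hm : ∀ N t, ∀ᵐ x ∂(m N t : Measure X), x ∈ K)
    {M : ℝ} (hM : 0 ≤ M) {δ : ℕ → ℝ} (hδ : Tendsto δ atTop (nhds 0))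
    (hequi : ∀ (L : NNReal) (f : X → ℝ), LipschitzWith L f →
      (∃ C : ℝ, ∀ x y, dist (f x) (f y) ≤ C) → ∀ N s t,
      |∫ x, f x ∂(m N s : Measure X) - ∫ x, f x ∂(m N t : Measure X)| ≤
        L * M * (dist s t + δ N)) :
    ∃ φ : ℕ → ℕ, StrictMono φ ∧ ∃ μ : I → ProbabilityMeasure X, ∀ t,
      (∀ᵐ x ∂(μ t : Measure X), x ∈ K) ∧ Tendsto (fun k => m (φ k) t) atTop (nhds (μ t)) := by
  set Q : Set (ProbabilityMeasure X) := {ν | ∀ n : ℕ, ν ((fun _ => K) n)ᶜ ≤ (fun _ => 0) n} with hQ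
  have hQc : IsCompact Q :=
    isCompact_setOfPred_probabilityMeasure_mass_eq_compl_isCompact_le
      (tendsto_const_nhds (x := (0 : NNReal))) (fun _ : ℕ => hK) (Or.inl inferInstance)
  have hQiff : ∀ ν : ProbabilityMeasure X, ν ∈ Q ↔ ∀ᵐ x ∂(ν : Measure X), x ∈ K := fun ν => by
    rw [ae_iff]
    simp only [hQ, Set.mem_ofPred_eq, nonpos_iff_eq_zero, forall_const]
    exact ProbabilityMeasure.null_iff_toMeasure_null ν Kᶜ
  set q := TopologicalSpace.denseSeq I with hq
  obtain ⟨ν, -, φ, hφ, hlim⟩ := (isCompact_univ_pi fun _ : ℕ => hQc).tendsto_subseq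
    (x := fun N i => m N (q i)) fun N i _ => (hQiff _).2 (hm N (q i))
  rw [tendsto_pi_nhds] at hlim
  have key : ∀ t, ∃ μ : ProbabilityMeasure X, (∀ᵐ x ∂(μ : Measure X), x ∈ K) ∧
      Tendsto (fun k => m (φ k) t) atTop (nhds μ) := by
    intro t
    obtain ⟨μ, hμQ, ψ, hψ, hμ⟩ := hQc.tendsto_subseq (x := fun k => m (φ k) t)
      fun k => (hQiff _).2 (hm _ t)
    refine ⟨μ, (hQiff μ).1 hμQ, tendsto_iff_forall_lipschitz_integral_tendsto.2 ?_⟩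
    rintro f hfb ⟨L, hL⟩
    have hμf := tendsto_iff_forall_lipschitz_integral_tendsto.1 hμ f hfb ⟨L, hL⟩
    refine tendsto_nhds_of_cauchySeq_of_subseq ?_ hψ.tendsto_atTop hμf
    rw [Metric.cauchySeq_iff']
    intro ε hε
    have hη : ∃ η > 0, L * M * (2 * η) < ε / 3 := by
      have : Tendsto (fun η : ℝ => L * M * (2 * η)) (nhdsWithin 0 (Set.Ioi 0)) (nhds 0) := by
        have : Continuous fun η : ℝ => L * M * (2 * η) := by fun_prop
        simpa using (this.tendsto 0).mono_left nhdsWithin_le_nhds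
      have h₁ := this.eventually (gt_mem_nhds (show 0 < ε / 3 by linarith))
      obtain ⟨η, h, h'⟩ := (h₁.and self_mem_nhdsWithin).exists
      exact ⟨η, h', h⟩
    obtain ⟨η, hη, hηε⟩ := hη
    obtain ⟨i, hi⟩ := (TopologicalSpace.denseRange_denseSeq I).exists_dist_lt t hη
    have hfi := tendsto_iff_forall_lipschitz_integral_tendsto.1 (hlim i) f hfb ⟨L, hL⟩
    obtain ⟨N₁, hN₁⟩ := Metric.cauchySeq_iff.1 hfi.cauchySeq (ε / 3) (by linarith)
    obtain ⟨N₂, hN₂⟩ := Metric.tendsto_atTop.1 (hδ.comp hφ.tendsto_atTop) η hη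
    have hnear : ∀ k ≥ N₂, |∫ x, f x ∂(m (φ k) t : Measure X) -
        ∫ x, f x ∂(m (φ k) (q i) : Measure X)| < ε / 3 := fun k hk => by
      refine (hequi L f hL hfb (φ k) t (q i)).trans_lt (lt_of_le_of_lt ?_ hηε)
      have := hN₂ k hk
      rw [Real.dist_eq, sub_zero, abs_lt] at this
      simp only [Function.comp_apply] at this
      gcongr
      linarith [this.2]
    refine ⟨max N₁ N₂, fun k hk => ?_⟩
    have h₁ := hnear k ((le_max_right _ _).trans hk)
    have h₂ := hnear _ (le_max_right N₁ N₂)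
    have h₃ := hN₁ k ((le_max_left _ _).trans hk) _ (le_max_left N₁ N₂)
    simp only [Function.comp_apply] at h₃
    rw [Real.dist_eq] at h₃ ⊢
    rw [abs_lt] at *
    constructor <;> linarith
  choose μ hμ using key
  exact ⟨φ, hφ, μ, hμ⟩

lemma isCompact_msupport {X : Type*} [MeasurableSpace X] [PseudoMetricSpace X] [ProperSpace X]
    {μ : Measure X} {x₀ : X} {R : ℝ} (h : ∀ᵐ x ∂μ, x ∈ Metric.closedBall x₀ R) :
    IsCompact (msupport μ) := by
  have hsub : msupport μ ⊆ Metric.closedBall x₀ R := fun x hx => by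
    by_contra hn
    exact hx _ Metric.isClosed_closedBall.isOpen_compl hn h
  have hcl : IsClosed (msupport μ) := by
    rw [← isOpen_compl_iff, isOpen_iff_forall_mem_open]
    intro x hx
    simp only [msupport, Set.mem_compl_iff, Set.mem_ofPred_eq, not_forall, not_not] at hx
    obtain ⟨s, hs, hxs, h0⟩ := hx
    exact ⟨s, fun y hy hy' => hy' s hs hy h0, hs, hxs⟩
  exact (isCompact_closedBall x₀ R).of_isClosed_subset hcl hsub

lemma ae_mem_msupport {X : Type*} [MeasurableSpace X] [TopologicalSpace X]
    [SecondCountableTopology X] (μ : Measure X) : ∀ᵐ x ∂μ, x ∈ msupport μ := by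
  refine measure_null_of_locally_null _ fun x hx => ?_
  simp only [msupport, Set.mem_compl_iff, Set.mem_ofPred_eq, not_forall, not_not] at hx
  obtain ⟨s, hs, hxs, h0⟩ := hx
  exact ⟨s, mem_nhdsWithin_of_mem_nhds (hs.mem_nhds hxs), h0⟩

lemma abs_integral_sub_le_of_isCoupling {X U : Type*} [MeasurableSpace X] [PseudoMetricSpace X]
    [BorelSpace X] [SecondCountableTopology X] [PseudoMetricSpace U] [CompactSpace U]
    [MeasurableSpace U] [BorelSpace U] [SecondCountableTopology U]
    {σ τ : Measure (X × U)} [IsProbabilityMeasure σ]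
    {S : Measure ((X × U) × (X × U))} (hS : IsCoupling S σ τ)
    {K : Set X} (hK : Bornology.IsBounded K) (hσ : ∀ᵐ p ∂σ, p.1 ∈ K) (hτ : ∀ᵐ p ∂τ, p.1 ∈ K)
    {ψ : X × U → ℝ} (iσ : Integrable ψ σ) (iτ : Integrable ψ τ) {C : ℝ}
    (hψ : ∀ p q, |ψ p - ψ q| ≤ C * (dist p.1 q.1 + dist p.2 q.2)) :
    |∫ p, ψ p ∂σ - ∫ p, ψ p ∂τ| ≤
      C * (∫ q, dist q.1.1 q.2.1 ∂S + ∫ q, dist q.1.2 q.2.2 ∂S) := by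
  have := hS.isProbabilityMeasure
  obtain ⟨h₁, h₂⟩ := hS
  have e₁ : ∫ p, ψ p ∂σ = ∫ q, ψ q.1 ∂S := by
    rw [← h₁] at iσ ⊢
    exact integral_map measurable_fst.aemeasurable iσ.aestronglyMeasurable
  have e₂ : ∫ p, ψ p ∂τ = ∫ q, ψ q.2 ∂S := by
    rw [← h₂] at iτ ⊢
    exact integral_map measurable_snd.aemeasurable iτ.aestronglyMeasurable
  have i₁ : Integrable (fun q => ψ q.1) S := by
    rw [← h₁] at iσ
    exact iσ.comp_measurable measurable_fst
  have i₂ : Integrable (fun q => ψ q.2) S := by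
    rw [← h₂] at iτ
    exact iτ.comp_measurable measurable_snd
  have k₁ : ∀ᵐ q ∂S, q.1.1 ∈ K := by
    rw [← h₁] at hσ
    exact ae_of_ae_map measurable_fst.aemeasurable hσ
  have k₂ : ∀ᵐ q ∂S, q.2.1 ∈ K := by
    rw [← h₂] at hτ
    exact ae_of_ae_map measurable_snd.aemeasurable hτ
  have j₁ : Integrable (fun q : (X × U) × (X × U) => dist q.1.1 q.2.1) S := by
    refine Integrable.of_bound (by fun_prop) (Metric.diam K) ?_
    filter_upwards [k₁, k₂] with q hq hq'
    rw [Real.norm_of_nonneg dist_nonneg]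
    exact Metric.dist_le_diam_of_mem hK hq hq'
  have j₂ : Integrable (fun q : (X × U) × (X × U) => dist q.1.2 q.2.2) S := by
    refine Integrable.of_bound (by fun_prop) (Metric.diam (Set.univ : Set U)) ?_
    refine Eventually.of_forall fun q => ?_
    rw [Real.norm_of_nonneg dist_nonneg]
    exact Metric.dist_le_diam_of_mem isCompact_univ.isBounded (Set.mem_univ _) (Set.mem_univ _)
  rw [e₁, e₂, ← integral_sub i₁ i₂, ← integral_add j₁ j₂, ← integral_const_mul]
  exact abs_integral_le_integral_abs.trans
    (integral_mono (i₁.sub i₂).abs ((j₁.add j₂).const_mul C) fun q => hψ _ _)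

lemma abs_sub_sub_fderiv_le {E : Type*} [NormedAddCommGroup E] [NormedSpace ℝ E]
    {g : E → ℝ} (hg : Differentiable ℝ g) {L : NNReal} (hL : LipschitzWith L (fderiv ℝ g))
    (x v : E) : |g (x + v) - g x - fderiv ℝ g x v| ≤ L * ‖v‖ ^ 2 := by
  have h := (convex_closedBall x ‖v‖).norm_image_sub_le_of_norm_fderiv_le' (𝕜 := ℝ) (f := g)
    (C := L * ‖v‖) (φ := fderiv ℝ g x) (x := x) (y := x + v) (fun z _ => hg z) (fun z hz => by
      rw [← dist_eq_norm]
      exact (hL.dist_le_mul z x).trans (by gcongr; exact hz))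
    (Metric.mem_closedBall_self (norm_nonneg _)) (by simp)
  rw [add_sub_cancel_left, Real.norm_eq_abs] at h
  linarith

lemma exists_lipschitz_fderiv_apply {E U : Type*} [NormedAddCommGroup E] [NormedSpace ℝ E]
    [FiniteDimensional ℝ E] [PseudoMetricSpace U] {f : E → U → E} {Lf C : ℝ} (hLf : 0 ≤ Lf)
    (hlip : ∀ x y u₁ u₂, ‖f x u₁ - f y u₂‖ ≤ Lf * (‖x - y‖ + dist u₁ u₂)) (hC : 0 ≤ C)
    (hf : ∀ x u, ‖f x u‖ ≤ C * (1 + ‖x‖))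
    {g : E → ℝ} (hg : ContDiff ℝ (⊤ : ℕ∞) g) (hc : HasCompactSupport g) :
    ∃ D B : ℝ, 0 ≤ B ∧ (∀ p q : E × U, |fderiv ℝ g p.1 (f p.1 p.2) - fderiv ℝ g q.1 (f q.1 q.2)| ≤
      D * (dist p.1 q.1 + dist p.2 q.2)) ∧
      ∀ p : E × U, |fderiv ℝ g p.1 (f p.1 p.2)| ≤ B := by
  have hc' : HasCompactSupport (fderiv ℝ g) := hc.fderiv ℝ
  have hg' : ContDiff ℝ (⊤ : ℕ∞) (fderiv ℝ g) := (contDiff_infty_iff_fderiv.1 hg).2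
  obtain ⟨L, hL⟩ := hg'.lipschitzWith_of_hasCompactSupport hc' (by simp)
  obtain ⟨A, hA⟩ := hg'.continuous.bounded_above_of_compact_support hc'
  obtain ⟨r, hr⟩ := hc'.isBounded.subset_closedBall 0
  have hA0 : 0 ≤ A := (norm_nonneg _).trans (hA 0)
  have hr' : ∀ x, fderiv ℝ g x ≠ 0 → ‖x‖ ≤ |r| := fun x hx => by
    simpa using (Metric.mem_closedBall.1 (hr (subset_tsupport _ hx))).trans (le_abs_self r)
  have hfr : ∀ x u, fderiv ℝ g x ≠ 0 → ‖f x u‖ ≤ C * (1 + |r|) := fun x u hx =>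
    (hf x u).trans (by have := hr' x hx; gcongr)
  have hmain : ∀ p q : E × U, fderiv ℝ g q.1 ≠ 0 →
      |fderiv ℝ g p.1 (f p.1 p.2) - fderiv ℝ g q.1 (f q.1 q.2)| ≤
      (L * (C * (1 + |r|)) + A * Lf) * (dist p.1 q.1 + dist p.2 q.2) := fun p q hq => by
    have e : fderiv ℝ g p.1 (f p.1 p.2) - fderiv ℝ g q.1 (f q.1 q.2) =
        (fderiv ℝ g p.1 - fderiv ℝ g q.1) (f q.1 q.2) +
          fderiv ℝ g p.1 (f p.1 p.2 - f q.1 q.2) := by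
      rw [map_sub, sub_apply]
      ring
    rw [e, ← Real.norm_eq_abs]
    have h₁ : ‖(fderiv ℝ g p.1 - fderiv ℝ g q.1) (f q.1 q.2)‖ ≤
        L * dist p.1 q.1 * (C * (1 + |r|)) := by
      refine (ContinuousLinearMap.le_opNorm _ _).trans ?_
      rw [← dist_eq_norm]
      gcongr
      · exact hL.dist_le_mul _ _
      · exact hfr _ _ hq
    have h₂ : ‖fderiv ℝ g p.1 (f p.1 p.2 - f q.1 q.2)‖ ≤
        A * (Lf * (dist p.1 q.1 + dist p.2 q.2)) := by
      refine (ContinuousLinearMap.le_opNorm _ _).trans ?_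
      rw [dist_eq_norm p.1]
      gcongr
      · exact hA _
      · exact hlip _ _ _ _
    have h₃ : 0 ≤ L * (C * (1 + |r|)) * dist p.2 q.2 := by positivity
    refine (norm_add_le _ _).trans ?_
    linarith
  refine ⟨L * (C * (1 + |r|)) + A * Lf, A * (C * (1 + |r|)), by positivity, fun p q => ?_,
    fun p => ?_⟩
  · by_cases hq : fderiv ℝ g q.1 = 0
    · by_cases hp : fderiv ℝ g p.1 = 0
      · rw [hp, hq]
        simp only [zero_apply, sub_zero, abs_zero]
        positivity
      · rw [abs_sub_comm, dist_comm p.1, dist_comm p.2]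
        exact hmain q p hp
    · exact hmain p q hq
  · by_cases hp : fderiv ℝ g p.1 = 0
    · rw [hp]
      simp only [zero_apply, abs_zero]
      positivity
    · rw [← Real.norm_eq_abs]
      refine (ContinuousLinearMap.le_opNorm _ _).trans ?_
      gcongr
      · exact hA _
      · exact hfr _ _ hp

lemma exists_linear_growth {E U : Type*} [NormedAddCommGroup E]
    [PseudoMetricSpace U] [CompactSpace U] {f : E → U → E} {Lf : ℝ} (hLf : 0 ≤ Lf)
    (hlip : ∀ x y u₁ u₂, ‖f x u₁ - f y u₂‖ ≤ Lf * (‖x - y‖ + dist u₁ u₂)) :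
    ∃ C : ℝ, 0 ≤ C ∧ ∀ x u, ‖f x u‖ ≤ C * (1 + ‖x‖) := by
  rcases isEmpty_or_nonempty U with h | ⟨⟨u₀⟩⟩
  · exact ⟨0, le_rfl, fun x u => isEmptyElim u⟩
  · have hD : (0 : ℝ) ≤ Metric.diam (Set.univ : Set U) := Metric.diam_nonneg
    refine ⟨‖f 0 u₀‖ + Lf * (1 + Metric.diam (Set.univ : Set U)), by positivity, fun x u => ?_⟩
    have h₁ := hlip x 0 u u₀
    have h₂ : dist u u₀ ≤ Metric.diam (Set.univ : Set U) :=
      Metric.dist_le_diam_of_mem isCompact_univ.isBounded (Set.mem_univ _) (Set.mem_univ _)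
    have h₃ := norm_sub_norm_le (f x u) (f 0 u₀)
    rw [sub_zero] at h₁
    have h₄ : Lf * (‖x‖ + dist u u₀) ≤ Lf * (‖x‖ + Metric.diam (Set.univ : Set U)) := by gcongr
    have h₅ : 0 ≤ ‖f 0 u₀‖ * ‖x‖ := by positivity
    have h₆ : 0 ≤ Lf * (1 + Metric.diam (Set.univ : Set U) * ‖x‖) := by positivity
    nlinarith

lemma intervalIntegrable_comp_floor {a : ℕ → ℝ} {B : ℝ} (hB : ∀ j, |a j| ≤ B) (τ s t : ℝ) :
    IntervalIntegrable (fun r => a ⌊r / τ⌋₊) volume s t := by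
  refine (intervalIntegrable_const (c := B)).mono_fun' ?_ (Eventually.of_forall fun r => hB _)
  exact ((measurable_of_countable a).comp
    (Nat.measurable_floor.comp (measurable_id.div_const τ))).aestronglyMeasurable

lemma integral_comp_floor {a : ℕ → ℝ} {B : ℝ} (hB : ∀ j, |a j| ≤ B) {τ : ℝ} (hτ : 0 < τ) (k : ℕ) :
    ∫ r in (0 : ℝ)..k * τ, a ⌊r / τ⌋₊ = ∑ j ∈ Finset.range k, τ * a j := by
  induction k with
  | zero => simp
  | succ k ih =>
    rw [Finset.sum_range_succ, ← ih, ← intervalIntegral.integral_add_adjacent_intervals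
      (intervalIntegrable_comp_floor hB τ 0 (k * τ)) (intervalIntegrable_comp_floor hB τ _ _)]
    congr 1
    rw [show τ * a k = ∫ r in (k * τ)..((k + 1 : ℕ) * τ), a k by
      rw [intervalIntegral.integral_const, smul_eq_mul]; push_cast; ring]
    refine intervalIntegral.integral_congr_ae ?_
    filter_upwards [compl_mem_ae_iff.2 (measure_singleton (((k + 1 : ℕ) : ℝ) * τ))] with r hr hr'
    rw [Set.uIoc_of_le (by push_cast; nlinarith)] at hr'
    have h₁ : r < ((k + 1 : ℕ) : ℝ) * τ := lt_of_le_of_ne hr'.2 hr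
    congr 1
    rw [Nat.floor_eq_iff (div_nonneg ((by positivity : (0 : ℝ) ≤ k * τ).trans hr'.1.le) hτ.le)]
    exact ⟨(le_div_iff₀ hτ).2 hr'.1.le, (div_lt_iff₀ hτ).2 (by exact_mod_cast h₁)⟩

lemma abs_integral_comp_floor_sub_sum_le {a : ℕ → ℝ} {B : ℝ} (hB : ∀ j, |a j| ≤ B)
    {τ : ℝ} (hτ : 0 < τ) {t : ℝ} (ht : 0 ≤ t) :
    |(∫ r in (0 : ℝ)..t, a ⌊r / τ⌋₊) - ∑ j ∈ Finset.range ⌊t / τ⌋₊, τ * a j| ≤ B * τ := by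
  have h₁ : (⌊t / τ⌋₊ : ℝ) * τ ≤ t := (le_div_iff₀ hτ).1 (Nat.floor_le (by positivity))
  have h₂ : t < (⌊t / τ⌋₊ + 1) * τ := (div_lt_iff₀ hτ).1 (Nat.lt_floor_add_one _)
  rw [← integral_comp_floor hB hτ, intervalIntegral.integral_interval_sub_left
    (intervalIntegrable_comp_floor hB τ _ _) (intervalIntegrable_comp_floor hB τ _ _)]
  refine (intervalIntegral.norm_integral_le_of_norm_le_const (C := B)
    (f := fun r => a ⌊r / τ⌋₊) fun r _ => hB _).trans ?_
  have hB0 : 0 ≤ B := (abs_nonneg _).trans (hB 0)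
  gcongr
  rw [abs_of_nonneg (by linarith)]
  linarith

/-- One explicit Euler step of length `τ` for the measure control `w`. -/
noncomputable def eulerStep {E U : Type*} [NormedAddCommGroup E] [NormedSpace ℝ E]
    [MeasurableSpace E] [MeasurableSpace U] (f : E → U → E) (w : Measure E → Measure (E × U))
    (τ : ℝ) (μ : Measure E) : Measure E :=
  (w μ).map fun p => p.1 + τ • f p.1 p.2

/-- The explicit Euler scheme of step `τ` started at `μ₀`. -/
noncomputable def euler {E U : Type*} [NormedAddCommGroup E] [NormedSpace ℝ E]
    [MeasurableSpace E] [MeasurableSpace U] (f : E → U → E) (w : Measure E → Measure (E × U))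
    (τ : ℝ) (μ₀ : Measure E) (k : ℕ) : Measure E :=
  (eulerStep f w τ)^[k] μ₀

lemma euler_succ {E U : Type*} [NormedAddCommGroup E] [NormedSpace ℝ E] [MeasurableSpace E]
    [MeasurableSpace U] (f : E → U → E) (w : Measure E → Measure (E × U)) (τ : ℝ)
    (μ₀ : Measure E) (k : ℕ) : euler f w τ μ₀ (k + 1) =
      (w (euler f w τ μ₀ k)).map fun p => p.1 + τ • f p.1 p.2 := by
  rw [euler, Function.iterate_succ_apply']
  rfl

lemma ae_fst_mem {E U : Type*} [MeasurableSpace E] [MeasurableSpace U]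
    {w : Measure E → Measure (E × U)}
    (hw : ∀ μ, IsProbabilityMeasure μ → IsProbabilityMeasure (w μ) ∧ (w μ).map Prod.fst = μ)
    {μ : Measure E} (hμ : IsProbabilityMeasure μ) {P : E → Prop} (h : ∀ᵐ x ∂μ, P x) :
    ∀ᵐ p ∂(w μ), P p.1 := by
  rw [← (hw μ hμ).2] at h
  exact ae_of_ae_map measurable_fst.aemeasurable h

section Euler

variable {E U : Type*} [NormedAddCommGroup E] [NormedSpace ℝ E] [MeasurableSpace E]
  [BorelSpace E] [SecondCountableTopology E] [MeasurableSpace U]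
  {f : E → U → E} {w : Measure E → Measure (E × U)} {μ₀ : Measure E} {C R T τ : ℝ}

lemma measurable_eulerMap (hfm : Measurable fun p : E × U => f p.1 p.2) (τ : ℝ) :
    Measurable fun p : E × U => p.1 + τ • f p.1 p.2 :=
  measurable_fst.add (hfm.const_smul τ)

lemma isProbabilityMeasure_euler (hfm : Measurable fun p : E × U => f p.1 p.2)
    (hw : ∀ μ, IsProbabilityMeasure μ → IsProbabilityMeasure (w μ) ∧ (w μ).map Prod.fst = μ)
    (hμ₀ : IsProbabilityMeasure μ₀) (τ : ℝ) (k : ℕ) :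
    IsProbabilityMeasure (euler f w τ μ₀ k) := by
  induction k with
  | zero => exact hμ₀
  | succ k ih =>
    rw [euler_succ]
    have := (hw _ ih).1
    exact Measure.isProbabilityMeasure_map (measurable_eulerMap hfm τ).aemeasurable

lemma ae_one_add_norm_le_euler (hfm : Measurable fun p : E × U => f p.1 p.2)
    (hw : ∀ μ, IsProbabilityMeasure μ → IsProbabilityMeasure (w μ) ∧ (w μ).map Prod.fst = μ)
    (hμ₀ : IsProbabilityMeasure μ₀) (hf : ∀ x u, ‖f x u‖ ≤ C * (1 + ‖x‖)) (hC : 0 ≤ C)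
    (hτ : 0 ≤ τ) (hR : ∀ᵐ x ∂μ₀, ‖x‖ ≤ R) (k : ℕ) :
    ∀ᵐ x ∂(euler f w τ μ₀ k), 1 + ‖x‖ ≤ (1 + τ * C) ^ k * (1 + R) := by
  induction k with
  | zero =>
    filter_upwards [hR] with x hx
    simpa using hx
  | succ k ih =>
    have hp := isProbabilityMeasure_euler hfm hw hμ₀ τ k
    rw [euler_succ, ae_map_iff (measurable_eulerMap hfm τ).aemeasurable
      (measurableSet_le (by fun_prop) (by fun_prop))]
    filter_upwards [ae_fst_mem hw hp ih] with p h
    have h₁ : ‖τ • f p.1 p.2‖ ≤ τ * (C * (1 + ‖p.1‖)) := by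
      rw [norm_smul, Real.norm_of_nonneg hτ]
      exact mul_le_mul_of_nonneg_left (hf _ _) hτ
    have h₂ := norm_add_le p.1 (τ • f p.1 p.2)
    have h₃ : (1 + τ * C) * (1 + ‖p.1‖) ≤ (1 + τ * C) * ((1 + τ * C) ^ k * (1 + R)) :=
      mul_le_mul_of_nonneg_left h (by positivity)
    rw [pow_succ']
    linarith

lemma ae_mem_closedBall_euler (hfm : Measurable fun p : E × U => f p.1 p.2)
    (hw : ∀ μ, IsProbabilityMeasure μ → IsProbabilityMeasure (w μ) ∧ (w μ).map Prod.fst = μ)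
    (hμ₀ : IsProbabilityMeasure μ₀) (hf : ∀ x u, ‖f x u‖ ≤ C * (1 + ‖x‖)) (hC : 0 ≤ C)
    (hτ : 0 ≤ τ) (hR0 : 0 ≤ R) (hR : ∀ᵐ x ∂μ₀, ‖x‖ ≤ R) {k : ℕ} (hk : k * τ ≤ T) :
    ∀ᵐ x ∂(euler f w τ μ₀ k), x ∈ Metric.closedBall 0 (Real.exp (T * C) * (1 + R)) := by
  filter_upwards [ae_one_add_norm_le_euler hfm hw hμ₀ hf hC hτ hR k] with x hx
  have h₁ : (1 + τ * C) ^ k ≤ Real.exp (T * C) := by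
    calc (1 + τ * C) ^ k ≤ Real.exp (τ * C) ^ k := by
          gcongr
          linarith [Real.add_one_le_exp (τ * C)]
      _ = Real.exp (k * τ * C) := by rw [← Real.exp_nat_mul, mul_assoc]
      _ ≤ _ := by gcongr
  have h₂ : (1 + τ * C) ^ k * (1 + R) ≤ Real.exp (T * C) * (1 + R) := by gcongr
  rw [mem_closedBall_zero_iff]
  linarith

lemma integral_euler_succ (hfm : Measurable fun p : E × U => f p.1 p.2)
    (hw : ∀ μ, IsProbabilityMeasure μ → IsProbabilityMeasure (w μ) ∧ (w μ).map Prod.fst = μ)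
    (hμ₀ : IsProbabilityMeasure μ₀) {h : E → ℝ} (hh : Continuous h) (τ : ℝ) (k : ℕ) :
    ∫ x, h x ∂(euler f w τ μ₀ (k + 1)) =
        ∫ p, h (p.1 + τ • f p.1 p.2) ∂(w (euler f w τ μ₀ k)) ∧
      ∫ x, h x ∂(euler f w τ μ₀ k) = ∫ p, h p.1 ∂(w (euler f w τ μ₀ k)) := by
  have hp := isProbabilityMeasure_euler hfm hw hμ₀ τ k
  constructor
  · rw [euler_succ, integral_map (measurable_eulerMap hfm τ).aemeasurable
      hh.aestronglyMeasurable]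
  · conv_lhs => rw [← (hw _ hp).2]
    rw [integral_map measurable_fst.aemeasurable hh.aestronglyMeasurable]

lemma integrable_of_dist_bounded {X : Type*} [MeasurableSpace X] {ν : Measure X}
    [IsFiniteMeasure ν] {h : X → ℝ} (hm : AEStronglyMeasurable h ν) {D : ℝ}
    (hD : ∀ x y, dist (h x) (h y) ≤ D) : Integrable h ν := by
  rcases isEmpty_or_nonempty X with hX | ⟨⟨x₀⟩⟩
  · rw [Measure.eq_zero_of_isEmpty ν]
    exact integrable_zero_measure
  · refine Integrable.of_bound hm (D + ‖h x₀‖) (Eventually.of_forall fun x => ?_)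
    have := hD x x₀
    rw [dist_eq_norm] at this
    linarith [norm_sub_norm_le (h x) (h x₀)]

lemma abs_integral_euler_succ_sub_le (hfm : Measurable fun p : E × U => f p.1 p.2)
    (hw : ∀ μ, IsProbabilityMeasure μ → IsProbabilityMeasure (w μ) ∧ (w μ).map Prod.fst = μ)
    (hμ₀ : IsProbabilityMeasure μ₀) (hτ : 0 ≤ τ) {k : ℕ} {M : ℝ}
    (hM : ∀ᵐ p ∂(w (euler f w τ μ₀ k)), ‖f p.1 p.2‖ ≤ M)
    {L : NNReal} {h : E → ℝ} (hL : LipschitzWith L h) {D : ℝ} (hD : ∀ x y, dist (h x) (h y) ≤ D) :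
    |∫ x, h x ∂(euler f w τ μ₀ (k + 1)) - ∫ x, h x ∂(euler f w τ μ₀ k)| ≤ L * M * τ := by
  have hp := isProbabilityMeasure_euler hfm hw hμ₀ τ k
  have := (hw _ hp).1
  obtain ⟨e₁, e₂⟩ := integral_euler_succ hfm hw hμ₀ hL.continuous τ k
  have m₁ : Measurable fun p : E × U => h (p.1 + τ • f p.1 p.2) :=
    hL.continuous.measurable.comp (measurable_eulerMap hfm τ)
  have m₂ : Measurable fun p : E × U => h p.1 := hL.continuous.measurable.comp measurable_fst
  rw [e₁, e₂, ← integral_sub (integrable_of_dist_bounded m₁.aestronglyMeasurable fun _ _ => hD _ _)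
    (integrable_of_dist_bounded m₂.aestronglyMeasurable fun _ _ => hD _ _), ← Real.norm_eq_abs]
  refine (norm_integral_le_of_norm_le_const (C := L * M * τ) ?_).trans (by simp)
  filter_upwards [hM] with p hp
  rw [← dist_eq_norm]
  refine (hL.dist_le_mul _ _).trans ?_
  rw [dist_eq_norm, add_sub_cancel_left, norm_smul, Real.norm_of_nonneg hτ, mul_assoc,
    mul_comm M]
  gcongr

lemma abs_integral_euler_sub_le (hfm : Measurable fun p : E × U => f p.1 p.2)
    (hw : ∀ μ, IsProbabilityMeasure μ → IsProbabilityMeasure (w μ) ∧ (w μ).map Prod.fst = μ)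
    (hμ₀ : IsProbabilityMeasure μ₀) (hτ : 0 ≤ τ) {M : ℝ}
    (hM : ∀ k : ℕ, k * τ ≤ T → ∀ᵐ p ∂(w (euler f w τ μ₀ k)), ‖f p.1 p.2‖ ≤ M)
    {L : NNReal} {h : E → ℝ} (hL : LipschitzWith L h) {D : ℝ} (hD : ∀ x y, dist (h x) (h y) ≤ D)
    {i j : ℕ} (hij : i ≤ j) (hj : j * τ ≤ T) :
    |∫ x, h x ∂(euler f w τ μ₀ j) - ∫ x, h x ∂(euler f w τ μ₀ i)| ≤
      L * M * (j * τ - i * τ) := by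
  induction j, hij using Nat.le_induction with
  | base => simp
  | succ j hij ih =>
    push_cast at hj
    have hj' : j * τ ≤ T := by linarith
    have h₁ := ih hj'
    have h₂ := abs_integral_euler_succ_sub_le hfm hw hμ₀ hτ (hM j hj') hL hD
    have h₃ := abs_sub_le (∫ x, h x ∂(euler f w τ μ₀ (j + 1))) (∫ x, h x ∂(euler f w τ μ₀ j))
      (∫ x, h x ∂(euler f w τ μ₀ i))
    push_cast
    linarith

lemma abs_integral_euler_sub_sum_le (hfm : Measurable fun p : E × U => f p.1 p.2)
    (hw : ∀ μ, IsProbabilityMeasure μ → IsProbabilityMeasure (w μ) ∧ (w μ).map Prod.fst = μ)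
    (hμ₀ : IsProbabilityMeasure μ₀) (hτ : 0 ≤ τ) {M : ℝ}
    (hM : ∀ k : ℕ, k * τ ≤ T → ∀ᵐ p ∂(w (euler f w τ μ₀ k)), ‖f p.1 p.2‖ ≤ M)
    {g : E → ℝ} (hg : Differentiable ℝ g) {L : NNReal} (hL : LipschitzWith L (fderiv ℝ g))
    {D : ℝ} (hD : ∀ x y, dist (g x) (g y) ≤ D)
    (hi : ∀ μ, IsProbabilityMeasure μ → Integrable (fun p => fderiv ℝ g p.1 (f p.1 p.2)) (w μ))
    {k : ℕ} (hk : k * τ ≤ T) :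
    |∫ x, g x ∂(euler f w τ μ₀ k) - ∫ x, g x ∂μ₀ - ∑ j ∈ Finset.range k,
        τ * ∫ p, fderiv ℝ g p.1 (f p.1 p.2) ∂(w (euler f w τ μ₀ j))| ≤
      L * M ^ 2 * τ * (k * τ) := by
  induction k with
  | zero => simp [euler]
  | succ k ih =>
    push_cast at hk
    have hk' : k * τ ≤ T := by linarith
    have h₁ := ih hk'
    have hp := isProbabilityMeasure_euler hfm hw hμ₀ τ k
    have := (hw _ hp).1
    obtain ⟨e₁, e₂⟩ := integral_euler_succ hfm hw hμ₀ hg.continuous τ k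
    have m₁ : Measurable fun p : E × U => g (p.1 + τ • f p.1 p.2) :=
      hg.continuous.measurable.comp (measurable_eulerMap hfm τ)
    have m₂ : Measurable fun p : E × U => g p.1 := hg.continuous.measurable.comp measurable_fst
    have i₁ := integrable_of_dist_bounded (ν := w (euler f w τ μ₀ k)) m₁.aestronglyMeasurable
      fun _ _ => hD _ _
    have i₂ := integrable_of_dist_bounded (ν := w (euler f w τ μ₀ k)) m₂.aestronglyMeasurable
      fun _ _ => hD _ _
    have h₂ : |∫ x, g x ∂(euler f w τ μ₀ (k + 1)) - ∫ x, g x ∂(euler f w τ μ₀ k) -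
        τ * ∫ p, fderiv ℝ g p.1 (f p.1 p.2) ∂(w (euler f w τ μ₀ k))| ≤ L * M ^ 2 * τ * τ := by
      have i₃ : Integrable (fun p => g (p.1 + τ • f p.1 p.2) - g p.1) (w (euler f w τ μ₀ k)) :=
        i₁.sub i₂
      rw [e₁, e₂, ← integral_const_mul, ← integral_sub i₁ i₂,
        ← integral_sub i₃ ((hi _ hp).const_mul τ), ← Real.norm_eq_abs]
      refine (norm_integral_le_of_norm_le_const (C := L * M ^ 2 * τ * τ) ?_).trans (by simp)
      filter_upwards [hM k hk'] with p hp
      have h₃ := abs_sub_sub_fderiv_le hg hL p.1 (τ • f p.1 p.2)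
      rw [map_smul, smul_eq_mul, norm_smul, Real.norm_of_nonneg hτ, mul_pow] at h₃
      refine h₃.trans ?_
      have h₄ : ‖f p.1 p.2‖ ^ 2 ≤ M ^ 2 := by gcongr
      calc (L : ℝ) * (τ ^ 2 * ‖f p.1 p.2‖ ^ 2) ≤ L * (τ ^ 2 * M ^ 2) := by gcongr
        _ = _ := by ring
    rw [Finset.sum_range_succ]
    have h₃ := abs_add_le (∫ x, g x ∂(euler f w τ μ₀ k) - ∫ x, g x ∂μ₀ - ∑ j ∈ Finset.range k,
        τ * ∫ p, fderiv ℝ g p.1 (f p.1 p.2) ∂(w (euler f w τ μ₀ j)))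
      (∫ x, g x ∂(euler f w τ μ₀ (k + 1)) - ∫ x, g x ∂(euler f w τ μ₀ k) -
        τ * ∫ p, fderiv ℝ g p.1 (f p.1 p.2) ∂(w (euler f w τ μ₀ k)))
    push_cast
    refine le_trans (le_of_eq ?_) (h₃.trans ((add_le_add h₁ h₂).trans (le_of_eq ?_)))
    · congr 1
      ring
    · ring

end Euler

lemma floor_div_mul_le {τ t : ℝ} (hτ : 0 < τ) (ht : 0 ≤ t) : (⌊t / τ⌋₊ : ℝ) * τ ≤ t :=
  (le_div_iff₀ hτ).1 (Nat.floor_le (by positivity))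

lemma lt_floor_div_mul_add {τ t : ℝ} (hτ : 0 < τ) : t < (⌊t / τ⌋₊ : ℝ) * τ + τ := by
  have := (div_lt_iff₀ hτ).1 (Nat.lt_floor_add_one (t / τ))
  linarith

/-- **Peano-type theorem for measure controls.** If the measure control `ũ`
is `𝒲`-continuous at every compactly supported probability measure, then for every
compactly supported initial datum `μ₀` and every horizon `T > 0` the Cauchy problem
`μ̇ = V^ũ[μ]`, `μ(0) = μ₀` admits a solution in the sense of the integral identity against
smooth compactly supported test functions. -/
theorem peano_measure_controls
    {n : ℕ} {U : Type*} [MetricSpace U] [CompactSpace U]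
    [MeasurableSpace U] [BorelSpace U]
    (fhat : EuclideanSpace ℝ (Fin n) → U → EuclideanSpace ℝ (Fin n))
    (Lf : ℝ) (hLf : 0 < Lf)
    (hlip : ∀ (x y : EuclideanSpace ℝ (Fin n)) (u₁ u₂ : U),
      ‖fhat x u₁ - fhat y u₂‖ ≤ Lf * (‖x - y‖ + dist u₁ u₂))
    (utilde : Measure (EuclideanSpace ℝ (Fin n)) →
      Measure (EuclideanSpace ℝ (Fin n) × U))
    (hu : ∀ μ, IsProbabilityMeasure μ →
      IsProbabilityMeasure (utilde μ) ∧ (utilde μ).map Prod.fst = μ)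
    (hWcont : ∀ μ : Measure (EuclideanSpace ℝ (Fin n)), IsProbabilityMeasure μ →
      IsCompact (msupport μ) →
      ∀ μk : ℕ → Measure (EuclideanSpace ℝ (Fin n)),
        (∀ k, IsProbabilityMeasure (μk k)) → (∀ k, IsCompact (msupport (μk k))) →
        Tendsto (fun k => W1 (μk k) μ) atTop (nhds 0) →
        ∃ Sk : ℕ → Measure ((EuclideanSpace ℝ (Fin n) × U) ×
            (EuclideanSpace ℝ (Fin n) × U)),
          (∀ k, IsProbabilityMeasure (Sk k) ∧
            IsCoupling (Sk k) (utilde (μk k)) (utilde μ) ∧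
            IsOptimalCoupling ((Sk k).map (fun q => (q.1.1, q.2.1))) (μk k) μ) ∧
          Tendsto (fun k => ∫ q, dist q.1.2 q.2.2 ∂(Sk k)) atTop (nhds 0)) :
    ∀ μ₀ : Measure (EuclideanSpace ℝ (Fin n)), IsProbabilityMeasure μ₀ →
      IsCompact (msupport μ₀) → ∀ T > (0 : ℝ),
      ∃ μ : ℝ → Measure (EuclideanSpace ℝ (Fin n)),
        μ 0 = μ₀ ∧
        (∀ t ∈ Set.Icc (0 : ℝ) T,
          IsProbabilityMeasure (μ t) ∧ IsCompact (msupport (μ t))) ∧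
        (∀ g : EuclideanSpace ℝ (Fin n) → ℝ, ContDiff ℝ (⊤ : ℕ∞) g → HasCompactSupport g →
          ∀ t ∈ Set.Icc (0 : ℝ) T,
            ∫ x, g x ∂(μ t) = (∫ x, g x ∂μ₀) +
              ∫ s in (0 : ℝ)..t,
                ∫ p, ⟪gradient g p.1, fhat p.1 p.2⟫ ∂(utilde (μ s))) := by
  intro μ₀ hμ₀ hμc T hT
  have hfc : Continuous fun p : EuclideanSpace ℝ (Fin n) × U => fhat p.1 p.2 := by
    refine LipschitzWith.continuous (K := Real.toNNReal (Lf * 2)) (.of_dist_le_mul fun p q => ?_)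
    rw [dist_eq_norm, Real.coe_toNNReal _ (by positivity), mul_assoc]
    refine (hlip _ _ _ _).trans ?_
    rw [← dist_eq_norm, two_mul]
    gcongr
    · exact le_max_left _ _
    · exact le_max_right _ _
  have hfm := hfc.measurable
  obtain ⟨C, hC, hf⟩ := exists_linear_growth hLf.le hlip
  obtain ⟨R, hR⟩ := hμc.isBounded.subset_closedBall 0
  have hR' : ∀ᵐ x ∂μ₀, ‖x‖ ≤ |R| := by
    filter_upwards [ae_mem_msupport μ₀] with x hx
    simpa using (Metric.mem_closedBall.1 (hR hx)).trans (le_abs_self R)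
  set ρ := Real.exp (T * C) * (1 + |R|) with hρ
  have hρ0 : 0 ≤ ρ := by positivity
  set K : Set (EuclideanSpace ℝ (Fin n)) := Metric.closedBall 0 ρ with hK
  set M := C * (1 + ρ) with hM
  have hM0 : 0 ≤ M := by positivity
  set τ : ℕ → ℝ := fun N => 1 / ((N : ℝ) + 1) with hτ
  have hτ0 : ∀ N, 0 < τ N := fun N => Nat.one_div_pos_of_nat
  have hτlim : Tendsto τ atTop (nhds 0) := tendsto_one_div_add_atTop_nhds_zero_nat
  have hprob : ∀ N k, IsProbabilityMeasure (euler fhat utilde (τ N) μ₀ k) := fun N k =>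
    isProbabilityMeasure_euler hfm hu hμ₀ (τ N) k
  have hball : ∀ N (k : ℕ), k * τ N ≤ T → ∀ᵐ x ∂(euler fhat utilde (τ N) μ₀ k), x ∈ K :=
    fun N k hk => ae_mem_closedBall_euler hfm hu hμ₀ hf hC (hτ0 N).le (abs_nonneg R) hR' hk
  have hfM : ∀ N (k : ℕ), k * τ N ≤ T →
      ∀ᵐ p ∂(utilde (euler fhat utilde (τ N) μ₀ k)), ‖fhat p.1 p.2‖ ≤ M := fun N k hk => by
    filter_upwards [ae_fst_mem hu (hprob N k) (hball N k hk)] with p hp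
    refine (hf _ _).trans ?_
    rw [hK, mem_closedBall_zero_iff] at hp
    exact mul_le_mul_of_nonneg_left (by linarith) hC
  set m : ℕ → Set.Icc (0 : ℝ) T → ProbabilityMeasure (EuclideanSpace ℝ (Fin n)) :=
    fun N t => ⟨euler fhat utilde (τ N) μ₀ ⌊(t : ℝ) / τ N⌋₊, hprob N _⟩ with hm
  have hfloor : ∀ N (t : Set.Icc (0 : ℝ) T), ⌊(t : ℝ) / τ N⌋₊ * τ N ≤ T := fun N t =>
    (floor_div_mul_le (hτ0 N) t.2.1).trans t.2.2
  have : Nonempty (Set.Icc (0 : ℝ) T) := ⟨⟨0, le_rfl, hT.le⟩⟩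
  obtain ⟨φ, hφ, μ, hμ⟩ := exists_tendsto_subseq_of_equilipschitz (isCompact_closedBall 0 ρ) m
    (fun N t => hball N _ (hfloor N t)) hM0 hτlim (by
      have key : ∀ (L : NNReal) (h : EuclideanSpace ℝ (Fin n) → ℝ), LipschitzWith L h →
          (∃ C : ℝ, ∀ x y, dist (h x) (h y) ≤ C) → ∀ N (s t : Set.Icc (0 : ℝ) T), t ≤ s →
          |∫ x, h x ∂(m N s : Measure (EuclideanSpace ℝ (Fin n))) -
            ∫ x, h x ∂(m N t : Measure (EuclideanSpace ℝ (Fin n)))| ≤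
            L * M * (dist s t + τ N) := by
        rintro L h hL ⟨D, hD⟩ N s t hts
        have hts' : (t : ℝ) ≤ s := hts
        refine (abs_integral_euler_sub_le hfm hu hμ₀ (hτ0 N).le (hfM N) hL hD
          (Nat.floor_mono (div_le_div_of_nonneg_right hts' (hτ0 N).le)) (hfloor N s)).trans ?_
        gcongr
        rw [Subtype.dist_eq, Real.dist_eq, abs_of_nonneg (sub_nonneg.2 hts')]
        linarith [floor_div_mul_le (hτ0 N) s.2.1, lt_floor_div_mul_add (t := (t : ℝ)) (hτ0 N)]
      intro L h hL hD N s t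
      rcases le_total t s with hts | hts
      · exact key L h hL hD N s t hts
      · rw [abs_sub_comm, dist_comm]
        exact key L h hL hD N t s hts)
  refine ⟨fun t => (μ (Set.projIcc 0 T hT.le t) : Measure (EuclideanSpace ℝ (Fin n))), ?_,
    fun t ht => ⟨inferInstance, isCompact_msupport (hμ _).1⟩, ?_⟩
  · have h₀ : ∀ N, m N ⟨0, le_rfl, hT.le⟩ = ⟨μ₀, hμ₀⟩ := fun N =>
      Subtype.ext (by simp [hm, euler])
    have h₁ := (hμ ⟨0, le_rfl, hT.le⟩).2
    simp only [h₀] at h₁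
    have h₂ := tendsto_nhds_unique h₁ tendsto_const_nhds
    simp only [Set.projIcc_left]
    rw [h₂]
    rfl
  intro g hg hgc t ht
  obtain ⟨D, B, hB0, hD, hB⟩ := exists_lipschitz_fderiv_apply hLf.le hlip hC hf hg hgc
  have hgrad : ∀ σ, ∫ p, ⟪gradient g p.1, fhat p.1 p.2⟫ ∂(utilde σ) =
      ∫ p, fderiv ℝ g p.1 (fhat p.1 p.2) ∂(utilde σ) := fun σ => by
    simp [gradient]
  simp only [hgrad]
  have hψc : Continuous fun p : EuclideanSpace ℝ (Fin n) × U =>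
      fderiv ℝ g p.1 (fhat p.1 p.2) :=
    ((hg.continuous_fderiv (by simp)).comp continuous_fst).clm_apply hfc
  have hψi : ∀ σ, IsProbabilityMeasure σ →
      Integrable (fun p => fderiv ℝ g p.1 (fhat p.1 p.2)) (utilde σ) := fun σ hσ => by
    have := (hu σ hσ).1
    exact Integrable.of_bound hψc.aestronglyMeasurable B (Eventually.of_forall fun p => hB p)
  have hbd : ∀ σ, IsProbabilityMeasure σ →
      |∫ p, fderiv ℝ g p.1 (fhat p.1 p.2) ∂(utilde σ)| ≤ B := fun σ hσ => by
    have := (hu σ hσ).1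
    have h := norm_integral_le_of_norm_le_const (μ := utilde σ) (C := B)
      (f := fun p => fderiv ℝ g p.1 (fhat p.1 p.2)) (Eventually.of_forall fun p => hB p)
    simpa using h
  have hlim : ∀ s, Tendsto (fun k => ∫ p, fderiv ℝ g p.1 (fhat p.1 p.2)
      ∂(utilde (m (φ k) s : Measure (EuclideanSpace ℝ (Fin n))))) atTop
      (nhds (∫ p, fderiv ℝ g p.1 (fhat p.1 p.2)
        ∂(utilde (μ s : Measure (EuclideanSpace ℝ (Fin n)))))) := fun s => by
    have hW := tendsto_W1_of_tendsto (isCompact_closedBall 0 ρ).isBounded _ _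
      (fun k => hball (φ k) _ (hfloor (φ k) s)) (hμ s).1 (hμ s).2
    obtain ⟨S, hS, hS'⟩ := hWcont _ inferInstance (isCompact_msupport (hμ s).1) _
      (fun k => (inferInstance : IsProbabilityMeasure
        (m (φ k) s : Measure (EuclideanSpace ℝ (Fin n)))))
      (fun k => isCompact_msupport (hball (φ k) _ (hfloor (φ k) s))) hW
    rw [tendsto_iff_norm_sub_tendsto_zero]
    refine squeeze_zero (fun _ => norm_nonneg _) (fun k => ?_)
      (by simpa using (hW.add hS').const_mul D)
    obtain ⟨-, hSc, -, -, hopt⟩ := hS k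
    rw [integral_map (by fun_prop) (by fun_prop)] at hopt
    rw [← hopt]
    have hp : IsProbabilityMeasure (m (φ k) s : Measure (EuclideanSpace ℝ (Fin n))) := inferInstance
    have := (hu _ hp).1
    have := (hu (μ s) inferInstance).1
    exact abs_integral_sub_le_of_isCoupling hSc (isCompact_closedBall 0 ρ).isBounded
      (ae_fst_mem hu hp (hball (φ k) _ (hfloor (φ k) s)))
      (ae_fst_mem hu inferInstance (hμ s).1) (hψi _ hp) (hψi _ inferInstance) hD
  set a : ℕ → ℕ → ℝ := fun k j =>
    ∫ p, fderiv ℝ g p.1 (fhat p.1 p.2) ∂(utilde (euler fhat utilde (τ (φ k)) μ₀ j)) with ha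
  have hab : ∀ k j, |a k j| ≤ B := fun k j => hbd _ (hprob _ _)
  have hI : Tendsto (fun k => ∫ s in (0 : ℝ)..t, a k ⌊s / τ (φ k)⌋₊) atTop
      (nhds (∫ s in (0 : ℝ)..t, ∫ p, fderiv ℝ g p.1 (fhat p.1 p.2)
        ∂(utilde (μ (Set.projIcc 0 T hT.le s) : Measure (EuclideanSpace ℝ (Fin n)))))) := by
    refine intervalIntegral.tendsto_integral_filter_of_dominated_convergence (fun _ => B)
      (Eventually.of_forall fun k =>
        (intervalIntegrable_iff.1
          (intervalIntegrable_comp_floor (hab k) (τ (φ k)) 0 t)).aestronglyMeasurable)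
      (Eventually.of_forall fun k => Eventually.of_forall fun s _ => hab k _)
      intervalIntegrable_const (Eventually.of_forall fun s hs => ?_)
    rw [Set.uIoc_of_le ht.1] at hs
    have hs' : s ∈ Set.Icc 0 T := ⟨hs.1.le, hs.2.trans ht.2⟩
    rw [Set.projIcc_of_mem hT.le hs']
    exact hlim ⟨s, hs'⟩
  obtain ⟨L, hL⟩ := (contDiff_infty_iff_fderiv.1 hg).2.lipschitzWith_of_hasCompactSupport
    (hgc.fderiv ℝ) (by simp)
  obtain ⟨A, hA⟩ := hg.continuous.bounded_above_of_compact_support hgc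
  have hA' : ∀ x y, dist (g x) (g y) ≤ A + A := fun x y =>
    (dist_le_norm_add_norm _ _).trans (add_le_add (hA x) (hA y))
  have hgd : Differentiable ℝ g := hg.differentiable (by simp)
  have hg₁ : Tendsto (fun k => ∫ x, g x ∂(m (φ k) ⟨t, ht⟩ : Measure (EuclideanSpace ℝ (Fin n))))
      atTop (nhds (∫ x, g x ∂(μ ⟨t, ht⟩ : Measure (EuclideanSpace ℝ (Fin n))))) := by
    obtain ⟨L', hL'⟩ := hg.lipschitzWith_of_hasCompactSupport hgc (by simp)
    exact tendsto_iff_forall_lipschitz_integral_tendsto.1 (hμ ⟨t, ht⟩).2 g ⟨_, hA'⟩ ⟨L', hL'⟩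
  have herr : Tendsto (fun k =>
      ∫ x, g x ∂(m (φ k) ⟨t, ht⟩ : Measure (EuclideanSpace ℝ (Fin n))) - ∫ x, g x ∂μ₀ -
        ∫ s in (0 : ℝ)..t, a k ⌊s / τ (φ k)⌋₊) atTop (nhds 0) := by
    have hτφ := (hτlim.comp hφ.tendsto_atTop).const_mul (L * M ^ 2 * T + B)
    rw [mul_zero] at hτφ
    refine squeeze_zero_norm (fun k => ?_) hτφ
    have h₁ := abs_integral_euler_sub_sum_le hfm hu hμ₀ (hτ0 (φ k)).le (hfM (φ k)) hgd hL hA' hψi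
      (hfloor (φ k) ⟨t, ht⟩)
    have h₂ := abs_integral_comp_floor_sub_sum_le (hab k) (hτ0 (φ k)) ht.1
    have h₃ : L * M ^ 2 * τ (φ k) * (⌊t / τ (φ k)⌋₊ * τ (φ k)) ≤ L * M ^ 2 * τ (φ k) * T :=
      mul_le_mul_of_nonneg_left (hfloor (φ k) ⟨t, ht⟩) (by have := hτ0 (φ k); positivity)
    have h₄ := (h₁.trans h₃)
    simp only [Function.comp_apply]
    rw [Real.norm_eq_abs]
    rw [abs_le] at h₂ h₄ ⊢
    constructor <;> simp only [hm, ha, ProbabilityMeasure.coe_mk] at * <;>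
      linarith [h₂.1, h₂.2, h₄.1, h₄.2]
  have h₁ := tendsto_nhds_unique ((hg₁.sub_const _).sub hI) herr
  rw [Set.projIcc_of_mem hT.le ht]
  linarith
end

section
/- Let U be a compact metric space and f̂ : ℝⁿ × U → ℝⁿ Lipschitz with constant L_f > 0 with respect to ‖x−y‖ + d_U(u₁,u₂); set f(x,u) := (x, f̂(x,u)). Let ũ be a measure control which is C-𝒲-Lipschitz on compactly supported measures, in the following sense: for all compactly supported μ, ν and every ε > 0 there is a coupling S of ũ[μ] and ũ[ν] whose pushforward under ((x,u₁),(y,u₂)) ↦ (x,y) is an optimal coupling of μ and ν and which satisfies ∫ d_U(u₁,u₂) dS ≤ C · W₁(μ,ν) + ε. Then for all compactly supported μ, ν and every ε > 0 there exists a coupling T of V^ũ[μ] = f#(ũ[μ]) and V^ũ[ν] = f#(ũ[ν]) whose pushforward under ((x,v),(y,w)) ↦ (x,y) is an optimal coupling of μ and ν and which satisfies ∫ ‖v − w‖ dT((x,v),(y,w)) ≤ L_f (C + 1) W₁(μ,ν) + L_f ε. -/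
open MeasureTheory Metric

/-- The complement of the support is null in a second-countable space. -/
theorem measure_compl_msupport {X : Type*} [TopologicalSpace X] [SecondCountableTopology X]
    [MeasurableSpace X] (μ : Measure X) : μ (msupport μ)ᶜ = 0 := by
  refine measure_null_of_locally_null _ fun x hx => ?_
  simp only [msupport, Set.mem_compl_iff, Set.mem_ofPred_eq, not_forall, not_not] at hx
  obtain ⟨s, hs, hxs, h0⟩ := hx
  exact ⟨s, mem_nhdsWithin_of_mem_nhds (hs.mem_nhds hxs), h0⟩

/-- A finite measure with compact support has an integrable norm. -/
theorem integrable_norm_of_isCompact_msupport {E : Type*} [NormedAddCommGroup E]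
    [SecondCountableTopology E] [MeasurableSpace E] [BorelSpace E] (μ : Measure E)
    [IsFiniteMeasure μ] (h : IsCompact (msupport μ)) : Integrable (fun x => ‖x‖) μ := by
  obtain ⟨R, hR⟩ := h.isBounded.exists_norm_le
  refine Integrable.of_bound continuous_norm.aestronglyMeasurable R ?_
  have h0 : ∀ᵐ x ∂μ, x ∈ msupport μ := measure_compl_msupport μ
  filter_upwards [h0] with x hx
  simpa using hR x hx

/-- The graph map `(x, u) ↦ (x, g x u)` of a jointly Lipschitz map is continuous. -/
theorem continuous_graph_of_lipschitz {E F U : Type*} [NormedAddCommGroup E]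
    [NormedAddCommGroup F] [PseudoMetricSpace U] (g : E → U → F) (L : ℝ)
    (hg : ∀ (x y : E) (u₁ u₂ : U), ‖g x u₁ - g y u₂‖ ≤ L * (‖x - y‖ + dist u₁ u₂)) :
    Continuous (fun p : E × U => (p.1, g p.1 p.2)) := by
  refine continuous_fst.prodMk (continuous_iff_continuousAt.2 fun p => ?_)
  rw [ContinuousAt, tendsto_iff_norm_sub_tendsto_zero]
  refine squeeze_zero (fun _ => norm_nonneg _) (fun q => hg q.1 p.1 q.2 p.2) ?_
  have hc : Continuous (fun q : E × U => L * (‖q.1 - p.1‖ + dist q.2 p.2)) := by fun_prop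
  simpa using hc.tendsto p

/-- If the measure control `ũ` is `C`-`𝒲`-Lipschitz on compactly
supported measures, then the associated measure vector field `V^ũ[μ] = f#(ũ[μ])` admits,
for all compactly supported `μ, ν` and all `ε > 0`, couplings whose `(x,y)`-marginal is an
optimal coupling of `μ, ν` and whose velocity transport cost is bounded by
`L_f (C+1) W₁(μ,ν) + L_f ε`. -/
theorem measure_vector_field_W_lipschitz
    {n : ℕ} {U : Type*} [MetricSpace U] [CompactSpace U]
    [MeasurableSpace U] [BorelSpace U]
    (fhat : EuclideanSpace ℝ (Fin n) → U → EuclideanSpace ℝ (Fin n))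
    (Lf : ℝ) (hLf : 0 < Lf)
    (hlip : ∀ (x y : EuclideanSpace ℝ (Fin n)) (u₁ u₂ : U),
      ‖fhat x u₁ - fhat y u₂‖ ≤ Lf * (‖x - y‖ + dist u₁ u₂))
    (utilde : Measure (EuclideanSpace ℝ (Fin n)) →
      Measure (EuclideanSpace ℝ (Fin n) × U))
    (hu : ∀ μ, IsProbabilityMeasure μ →
      IsProbabilityMeasure (utilde μ) ∧ (utilde μ).map Prod.fst = μ)
    (C : ℝ) (hC : 0 < C)
    (hWLip : ∀ μ ν : Measure (EuclideanSpace ℝ (Fin n)),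
      IsProbabilityMeasure μ → IsProbabilityMeasure ν →
      IsCompact (msupport μ) → IsCompact (msupport ν) → ∀ ε > (0 : ℝ),
      ∃ S : Measure ((EuclideanSpace ℝ (Fin n) × U) ×
          (EuclideanSpace ℝ (Fin n) × U)),
        IsProbabilityMeasure S ∧ IsCoupling S (utilde μ) (utilde ν) ∧
        IsOptimalCoupling (S.map (fun q => (q.1.1, q.2.1))) μ ν ∧
        (∫ q, dist q.1.2 q.2.2 ∂S) ≤ C * W1 μ ν + ε) :
    ∀ μ ν : Measure (EuclideanSpace ℝ (Fin n)),
      IsProbabilityMeasure μ → IsProbabilityMeasure ν →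
      IsCompact (msupport μ) → IsCompact (msupport ν) → ∀ ε > (0 : ℝ),
      ∃ T : Measure ((EuclideanSpace ℝ (Fin n) × EuclideanSpace ℝ (Fin n)) ×
          (EuclideanSpace ℝ (Fin n) × EuclideanSpace ℝ (Fin n))),
        IsProbabilityMeasure T ∧
        IsCoupling T ((utilde μ).map (fun p => (p.1, fhat p.1 p.2)))
          ((utilde ν).map (fun p => (p.1, fhat p.1 p.2))) ∧
        IsOptimalCoupling (T.map (fun q => (q.1.1, q.2.1))) μ ν ∧
        (∫ q, ‖q.1.2 - q.2.2‖ ∂T) ≤ Lf * (C + 1) * W1 μ ν + Lf * ε := by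
  intro μ ν hμ hν hμc hνc ε hε
  obtain ⟨S, hS, ⟨hS1, hS2⟩, hopt, hcost⟩ := hWLip μ ν hμ hν hμc hνc ε hε
  have hG := (continuous_graph_of_lipschitz fhat Lf hlip).measurable
  have hGG : Measurable (Prod.map
      (fun p : EuclideanSpace ℝ (Fin n) × U => (p.1, fhat p.1 p.2))
      (fun p : EuclideanSpace ℝ (Fin n) × U => (p.1, fhat p.1 p.2))) := hG.prodMap hG
  have hπ : Measurable (fun q : (EuclideanSpace ℝ (Fin n) × U) ×
      (EuclideanSpace ℝ (Fin n) × U) => (q.1.1, q.2.1)) := by fun_prop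
  have hdist : (∫ q, ‖q.1.1 - q.2.1‖ ∂S) = W1 μ ν := by
    rw [← hopt.2.2, integral_map hπ.aemeasurable (by fun_prop)]
    simp only [dist_eq_norm]
  have hx : Integrable (fun q : (EuclideanSpace ℝ (Fin n) × U) ×
      (EuclideanSpace ℝ (Fin n) × U) => ‖q.1.1‖) S := by
    have h := integrable_norm_of_isCompact_msupport μ hμc
    rw [← (hu μ hμ).2, ← hS1, Measure.map_map measurable_fst measurable_fst] at h
    exact h.comp_measurable (measurable_fst.comp measurable_fst)
  have hy : Integrable (fun q : (EuclideanSpace ℝ (Fin n) × U) ×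
      (EuclideanSpace ℝ (Fin n) × U) => ‖q.2.1‖) S := by
    have h := integrable_norm_of_isCompact_msupport ν hνc
    rw [← (hu ν hν).2, ← hS2, Measure.map_map measurable_fst measurable_snd] at h
    exact h.comp_measurable (measurable_fst.comp measurable_snd)
  have hxy : Integrable (fun q : (EuclideanSpace ℝ (Fin n) × U) ×
      (EuclideanSpace ℝ (Fin n) × U) => ‖q.1.1 - q.2.1‖) S := by
    refine (hx.add hy).mono' (by fun_prop) (.of_forall fun q => ?_)
    simpa using norm_sub_le q.1.1 q.2.1
  have huu : Integrable (fun q : (EuclideanSpace ℝ (Fin n) × U) ×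
      (EuclideanSpace ℝ (Fin n) × U) => dist q.1.2 q.2.2) S := by
    refine Integrable.of_bound (by fun_prop) (diam (Set.univ : Set U)) (.of_forall fun q => ?_)
    rw [Real.norm_of_nonneg dist_nonneg]
    exact dist_le_diam_of_mem isCompact_univ.isBounded (Set.mem_univ _) (Set.mem_univ _)
  refine ⟨S.map (Prod.map (fun p => (p.1, fhat p.1 p.2)) (fun p => (p.1, fhat p.1 p.2))),
    Measure.isProbabilityMeasure_map hGG.aemeasurable, ⟨?_, ?_⟩, ?_, ?_⟩
  · rw [← hS1, Measure.map_map measurable_fst hGG, Measure.map_map hG measurable_fst]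
    rfl
  · rw [← hS2, Measure.map_map measurable_snd hGG, Measure.map_map hG measurable_snd]
    rfl
  · rw [Measure.map_map (by fun_prop) hGG]
    exact hopt
  · rw [integral_map hGG.aemeasurable (by fun_prop)]
    calc _ ≤ ∫ q, Lf * (‖q.1.1 - q.2.1‖ + dist q.1.2 q.2.2) ∂S :=
          integral_mono_of_nonneg (.of_forall fun _ => norm_nonneg _)
            ((hxy.add huu).const_mul Lf) (.of_forall fun q => hlip _ _ _ _)
      _ = Lf * (W1 μ ν + ∫ q, dist q.1.2 q.2.2 ∂S) := by
          rw [integral_const_mul, integral_add hxy huu, hdist]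
      _ ≤ Lf * (W1 μ ν + (C * W1 μ ν + ε)) := by gcongr
      _ = Lf * (C + 1) * W1 μ ν + Lf * ε := by ring
end
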